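/- arXiv:2304.03196 — 8 statements merged into one kernel-verified Lean document; each statement's English description precedes it below -/
import Mathlib

section
/- If a balanced presentation P of the trivial group can be converted to the trivial presentation by a finite sequence of moves of types (1), (2), (3), and (5), then P can be converted to the trivial presentation by a finite sequence of moves of types (1), (2), and (3) alone. -/
/-- Moves (1), (2), (3) on balanced presentations with a fixed number `n` of generators:
replacing a relator by its inverse, by its product with another relator, and by its
conjugate by a generator or the inverse of a generator. -/
inductive Move123 (n : ℕ) : (Fin n → FreeGroup (Fin n)) → (Fin n → FreeGroup (Fin n)) → Prop
  | inv (r : Fin n → FreeGroup (Fin n)) (i : Fin n) :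
      Move123 n r (Function.update r i (r i)⁻¹)
  | mul (r : Fin n → FreeGroup (Fin n)) (i j : Fin n) (hij : i ≠ j) :
      Move123 n r (Function.update r i (r i * r j))
  | conj (r : Fin n → FreeGroup (Fin n)) (i j : Fin n) :
      Move123 n r (Function.update r i (FreeGroup.of j * r i * (FreeGroup.of j)⁻¹))
  | conjInv (r : Fin n → FreeGroup (Fin n)) (i j : Fin n) :
      Move123 n r (Function.update r i ((FreeGroup.of j)⁻¹ * r i * FreeGroup.of j))

/-- Moves (1), (2), (3) and (5) on balanced presentations with a fixed number `n` of
generators: moves (1)-(3) together with applying an automorphism of the free group to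
every relator. -/
inductive Move1235 (n : ℕ) : (Fin n → FreeGroup (Fin n)) → (Fin n → FreeGroup (Fin n)) → Prop
  | inv (r : Fin n → FreeGroup (Fin n)) (i : Fin n) :
      Move1235 n r (Function.update r i (r i)⁻¹)
  | mul (r : Fin n → FreeGroup (Fin n)) (i j : Fin n) (hij : i ≠ j) :
      Move1235 n r (Function.update r i (r i * r j))
  | conj (r : Fin n → FreeGroup (Fin n)) (i j : Fin n) :
      Move1235 n r (Function.update r i (FreeGroup.of j * r i * (FreeGroup.of j)⁻¹))
  | conjInv (r : Fin n → FreeGroup (Fin n)) (i j : Fin n) :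
      Move1235 n r (Function.update r i ((FreeGroup.of j)⁻¹ * r i * FreeGroup.of j))
  | auto (r : Fin n → FreeGroup (Fin n)) (ψ : FreeGroup (Fin n) ≃* FreeGroup (Fin n)) :
      Move1235 n r (fun i => ψ (r i))


namespace ACN

open Relation

abbrev Reach (n : ℕ) := ReflTransGen (Move123 n)

theorem reach_inv {n : ℕ} (r : Fin n → FreeGroup (Fin n)) (i : Fin n) :
    Reach n r (Function.update r i (r i)⁻¹) := ReflTransGen.single (Move123.inv r i)

theorem reach_mul {n : ℕ} (r : Fin n → FreeGroup (Fin n)) {i j : Fin n} (h : i ≠ j) :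
    Reach n r (Function.update r i (r i * r j)) := ReflTransGen.single (Move123.mul r i j h)

theorem reach_conj {n : ℕ} (g : FreeGroup (Fin n)) : ∀ (r : Fin n → FreeGroup (Fin n)) (i : Fin n),
    Reach n r (Function.update r i (g * r i * g⁻¹)) := by
  induction g using FreeGroup.induction_on with
  | C1 => intro r i; simp; exact ReflTransGen.refl
  | of x => intro r i; exact ReflTransGen.single (Move123.conj r i x)
  | inv_of x _ =>
    intro r i
    have := ReflTransGen.single (Move123.conjInv r i x)
    simpa using this
  | mul x y hx hy =>
    intro r i
    have h1 := hy r i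
    have h2 := hx (Function.update r i (y * r i * y⁻¹)) i
    have := h1.trans h2
    simpa [mul_assoc] using this

theorem map_update {n : ℕ} (ψ : FreeGroup (Fin n) ≃* FreeGroup (Fin n))
    (r : Fin n → FreeGroup (Fin n)) (i : Fin n) (g : FreeGroup (Fin n)) :
    (fun k => ψ (Function.update r i g k)) = Function.update (fun k => ψ (r k)) i (ψ g) := by
  funext k
  by_cases h : k = i
  · subst h; simp
  · simp [h]

theorem reach_map {n : ℕ} (ψ : FreeGroup (Fin n) ≃* FreeGroup (Fin n))
    {r s : Fin n → FreeGroup (Fin n)} (h : Reach n r s) :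
    Reach n (fun i => ψ (r i)) (fun i => ψ (s i)) := by
  induction h with
  | refl => exact ReflTransGen.refl
  | tail _ hm ih =>
    refine ih.trans ?_
    cases hm with
    | inv i => rw [map_update, map_inv]; exact reach_inv (fun k => ψ (_)) i
    | mul i j hij => rw [map_update, map_mul]; exact reach_mul (fun k => ψ (_)) hij
    | conj i j =>
      rw [map_update, map_mul, map_mul, map_inv]; exact reach_conj _ (fun k => ψ (_)) i
    | conjInv i j =>
      rw [map_update, map_mul, map_mul, map_inv]
      simpa using reach_conj (ψ (FreeGroup.of j))⁻¹ (fun k => ψ (_)) i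

theorem reach_swap {n : ℕ} (r : Fin n → FreeGroup (Fin n)) {i j : Fin n} (h : i ≠ j) :
    Reach n r (r ∘ Equiv.swap i j) := by
  have h1 := reach_mul r h
  have h2 := h1.trans (reach_inv _ i)
  have h3 := h2.trans (reach_mul _ h.symm)
  have h4 := h3.trans (reach_inv _ j)
  have h5 := h4.trans (reach_mul _ h)
  have h6 := h5.trans (reach_inv _ i)
  convert h6 using 1
  funext k
  by_cases hi : k = i
  · subst hi; simp [h, h.symm]
  · by_cases hj : k = j
    · subst hj; simp [h, h.symm]
    · simp [hi, hj, Equiv.swap_apply_of_ne_of_ne]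

theorem reach_perm {n : ℕ} (σ : Equiv.Perm (Fin n)) : ∀ (r : Fin n → FreeGroup (Fin n)),
    Reach n r (r ∘ σ) := by
  induction σ using Equiv.Perm.swap_induction_on with
  | one => intro r; exact ReflTransGen.refl
  | swap_mul f x y hxy ih =>
    intro r
    exact (reach_swap r hxy).trans (ih (r ∘ Equiv.swap x y))

theorem reach_signs {n : ℕ} (r f : Fin n → FreeGroup (Fin n))
    (h : ∀ i, f i = r i ∨ f i = (r i)⁻¹) : Reach n r f := by
  have key : ∀ s : Finset (Fin n), Reach n r (fun i => if i ∈ s then f i else r i) := by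
    intro s
    induction s using Finset.induction_on with
    | empty => simpa using ReflTransGen.refl
    | insert a s ha ih =>
      rcases h a with h' | h'
      · convert ih using 2 with i
        by_cases hi : i = a
        · subst hi; simp [h', ha]
        · simp [hi]
      · refine ih.trans ?_
        convert reach_inv _ a using 1
        funext i
        by_cases hi : i = a
        · subst hi; simp [h', ha]
        · simp [hi]
  simpa using key Finset.univ

theorem reach_mul' {n : ℕ} (r : Fin n → FreeGroup (Fin n)) {i j : Fin n} (h : j ≠ i)
    (a b : FreeGroup (Fin n)) (ha : a = r i ∨ a = (r i)⁻¹) (hb : b = r j ∨ b = (r j)⁻¹) :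
    Reach n r (Function.update r j (b * a)) := by
  have h1 : Reach n r (Function.update (Function.update r i a) j b) := by
    apply reach_signs
    intro k
    by_cases hj : k = j
    · subst hj; simpa using hb
    · by_cases hi : k = i
      · subst hi; simpa [hj] using ha
      · simp [hi, hj]
  have h2 := h1.trans (reach_mul _ h)
  refine h2.trans ?_
  apply reach_signs
  intro k
  by_cases hj : k = j
  · subst hj; simp [h.symm]
  · by_cases hi : k = i
    · subst hi
      rcases ha with rfl | rfl <;> simp [hj]
    · simp [hi, hj]

end ACN

namespace ACN

open FreeGroup

section words

variable {α : Type} [DecidableEq α]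

/-- length of the longest common prefix -/
def lcp {β : Type} [DecidableEq β] : List β → List β → ℕ
  | a :: l, b :: m => if a = b then lcp l m + 1 else 0
  | _, _ => 0

theorem lcp_le_left {β : Type} [DecidableEq β] : ∀ l m : List β, lcp l m ≤ l.length
  | a :: l, b :: m => by
    have := lcp_le_left l m
    simp only [lcp, List.length_cons]; split <;> omega
  | [], _ => by simp [lcp]
  | _ :: _, [] => by simp [lcp]

theorem lcp_comm {β : Type} [DecidableEq β] : ∀ l m : List β, lcp l m = lcp m l
  | a :: l, b :: m => by
    have := lcp_comm l m
    simp only [lcp, this, eq_comm]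
  | [], [] => rfl
  | [], _ :: _ => by simp [lcp]
  | _ :: _, [] => by simp [lcp]

theorem lcp_self {β : Type} [DecidableEq β] : ∀ l : List β, lcp l l = l.length
  | a :: l => by simp [lcp, lcp_self l]
  | [] => by simp [lcp]

theorem lcp_take {β : Type} [DecidableEq β] : ∀ (l m : List β) (k : ℕ), k ≤ lcp l m →
    l.take k = m.take k
  | a :: l, b :: m, k => by
    intro h
    cases k with
    | zero => simp
    | succ k =>
      simp only [lcp] at h
      split at h
      · next hab => simp [hab, lcp_take l m k (by omega)]
      · omega
  | [], m, k => by intro h; simp [lcp] at h; simp [h]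
  | _ :: _, [], k => by intro h; simp [lcp] at h; simp [h]

theorem lcp_ultra {β : Type} [DecidableEq β] : ∀ l m p : List β,
    min (lcp l p) (lcp p m) ≤ lcp l m
  | a :: l, b :: m, c :: p => by
    have := lcp_ultra l m p
    simp only [lcp]
    by_cases h1 : a = c <;> by_cases h2 : c = b
    · subst h1; subst h2; simp; omega
    · simp [h2]
    · simp [h1]
    · simp [h1]
  | [], _, _ => by simp [lcp]
  | _ :: _, [], _ :: _ => by simp [lcp]
  | _ :: _, _, [] => by simp [lcp]

theorem isReduced_invRev {L : List (α × Bool)} (h : IsReduced L) : IsReduced (invRev L) := by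
  rw [isReduced_iff_reduce_eq] at h ⊢
  rw [reduce_invRev, h]

theorem norm_mk_of_isReduced {L : List (α × Bool)} (h : IsReduced L) :
    norm (mk L) = L.length := by
  rw [FreeGroup.norm, toWord_mk, h.reduce_eq]

theorem norm_lcp : ∀ (L M : List (α × Bool)), IsReduced L → IsReduced M →
    norm ((mk L)⁻¹ * mk M) + 2 * lcp L M = L.length + M.length
  | [], M => by
    intro _ h
    have : (mk ([] : List (α × Bool))) = 1 := rfl
    simp [lcp, this, norm_mk_of_isReduced h]
  | a :: L, [] => by
    intro h _
    have : (mk ([] : List (α × Bool))) = 1 := rfl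
    rw [this, mul_one, norm_inv_eq, norm_mk_of_isReduced h]; simp [lcp]
  | a :: L, b :: M => by
    intro h1 h2
    by_cases hab : a = b
    · subst hab
      have ih := norm_lcp L M (h1.infix (List.infix_cons (List.infix_refl L)))
        (h2.infix (List.infix_cons (List.infix_refl M)))
      have e : (mk (a :: L))⁻¹ * mk (a :: M) = (mk L)⁻¹ * mk M := by
        have e1 : mk (a :: L) = mk [a] * mk L := rfl
        have e2 : mk (a :: M) = mk [a] * mk M := rfl
        rw [e1, e2]; group
      rw [e]; simp only [lcp, if_true, List.length_cons]; omega
    · have hr : IsReduced (invRev (a :: L) ++ (b :: M)) := by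
        unfold FreeGroup.IsReduced
        rw [List.isChain_append]
        refine ⟨isReduced_invRev h1, h2, ?_⟩
        intro x hx y hy
        simp [invRev] at hx hy
        subst hx; subst hy
        simp only
        intro h
        by_contra h'
        apply hab
        apply Prod.ext h
        cases h3 : a.2 <;> cases h4 : b.2 <;> simp_all
      have e : (mk (a :: L))⁻¹ * mk (b :: M) = mk (invRev (a :: L) ++ (b :: M)) := rfl
      rw [e, norm_mk_of_isReduced hr]; simp [lcp, hab]

/-- Gromov product -/
def c (x y : FreeGroup α) : ℕ := lcp x.toWord y.toWord

theorem c_comm (x y : FreeGroup α) : c x y = c y x := lcp_comm _ _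

theorem c_self (x : FreeGroup α) : c x x = norm x := lcp_self _

theorem c_le_left (x y : FreeGroup α) : c x y ≤ norm x := lcp_le_left _ _

theorem c_ultra (x y z : FreeGroup α) : min (c x z) (c z y) ≤ c x y := lcp_ultra _ _ _

theorem norm_c (x y : FreeGroup α) : norm (x⁻¹ * y) + 2 * c x y = norm x + norm y := by
  have := norm_lcp x.toWord y.toWord isReduced_toWord isReduced_toWord
  rwa [mk_toWord, mk_toWord] at this

theorem norm_c' (x y : FreeGroup α) : norm (x * y) + 2 * c x⁻¹ y = norm x + norm y := by
  have := norm_c x⁻¹ y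
  rwa [inv_inv, norm_inv_eq] at this

theorem c_sq (v : FreeGroup α) (hv : v ≠ 1) : 2 * c v⁻¹ v < norm v := by
  by_contra hcon
  push Not at hcon
  have hpos : 0 < norm v := Nat.pos_of_ne_zero (by simpa [FreeGroup.norm_eq_zero] using hv)
  have hle := c_le_left v v⁻¹
  rw [c_comm] at hle
  have ht := lcp_take v⁻¹.toWord v.toWord (c v⁻¹ v) le_rfl
  have hr : IsReduced v.toWord := isReduced_toWord
  have hn : norm v = v.toWord.length := rfl
  rw [toWord_inv] at ht
  rw [hn] at hcon hpos hle
  clear hn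
  generalize c v⁻¹ v = k at *
  generalize v.toWord = L at *
  have hidx : ∀ i (h1 : i < k), L[i]'(by omega) =
      ((L[L.length - 1 - i]'(by omega)).1, !(L[L.length - 1 - i]'(by omega)).2) := by
    intro i h1
    have := congrArg (fun l => l[i]?) ht
    simp [List.getElem?_take, h1, invRev] at this
    rw [List.getElem?_reverse (by simp; omega)] at this
    simp at this
    rw [List.getElem?_eq_getElem (by omega), List.getElem?_eq_getElem (by omega)] at this
    simpa using this.symm
  have hchain := List.isChain_iff_getElem.1 hr
  rcases Nat.even_or_odd' L.length with ⟨m, hm | hm⟩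
  · have h1 := hidx (m - 1) (by omega)
    have h2 := hchain (m - 1) (by omega)
    have e : L.length - 1 - (m - 1) = m - 1 + 1 := by omega
    simp only [e] at h1
    rw [h1] at h2
    simp at h2
  · have h1 := hidx m (by omega)
    have e : L.length - 1 - m = m := by omega
    simp only [e] at h1
    have := congrArg Prod.snd h1
    simp at this

end words

end ACN

namespace ACN

open FreeGroup

section rank

variable {α : Type} [DecidableEq α]

def rk (e : α × Bool → ℕ) (B : ℕ) (L : List (α × Bool)) : ℕ := Nat.ofDigits B (L.map e).reverse

theorem rk_append (e : α × Bool → ℕ) (B : ℕ) (L M : List (α × Bool)) :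
    rk e B (L ++ M) = rk e B M + B ^ M.length * rk e B L := by
  simp [rk, Nat.ofDigits_append]

theorem rk_inj {e : α × Bool → ℕ} {B : ℕ} (hB : 1 < B) (he : Function.Injective e)
    (hlt : ∀ a, e a < B) {L M : List (α × Bool)} (hl : L.length = M.length)
    (h : rk e B L = rk e B M) : L = M := by
  have := Nat.ofDigits_inj_of_len_eq hB (by simpa using hl)
    (by simp only [List.mem_reverse, List.mem_map]; rintro l ⟨a, _, rfl⟩; exact hlt a)
    (by simp only [List.mem_reverse, List.mem_map]; rintro l ⟨a, _, rfl⟩; exact hlt a) h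
  exact List.map_injective_iff.2 he (List.reverse_injective this)

def hf (e : α × Bool → ℕ) (B : ℕ) (L : List (α × Bool)) : ℕ :=
  rk e B (L.take ((L.length + 1) / 2))

def tau (e : α × Bool → ℕ) (B : ℕ) (g : FreeGroup α) : ℕ := hf e B g.toWord + hf e B g⁻¹.toWord

theorem tau_inv (e : α × Bool → ℕ) (B : ℕ) (g : FreeGroup α) : tau e B g⁻¹ = tau e B g := by
  simp [tau, add_comm]

theorem half_split {v : FreeGroup α} {m : ℕ} (hv : v.norm = 2 * m) :
    v = mk (v.toWord.take m) * (mk (v⁻¹.toWord.take m))⁻¹ := by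
  have h1 : invRev (v⁻¹.toWord.take m) = v.toWord.drop m := by
    have hl : v.toWord.length = 2 * m := hv
    rw [toWord_inv, invRev, invRev, List.take_reverse, List.map_reverse, List.reverse_reverse]
    simp [List.map_drop, Function.comp_def, hl]
    congr 1; omega
  rw [inv_mk, h1, mul_mk, List.take_append_drop, mk_toWord]

theorem tau_lt {e : α × Bool → ℕ} {B : ℕ} (hB : 1 < B) {v z : FreeGroup α} {m : ℕ}
    (hv : v.norm = 2 * m) (hc : c v⁻¹ z = m) (hz : 2 * m ≤ z.norm)
    (h : rk e B (v.toWord.take m) < rk e B (v⁻¹.toWord.take m)) :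
    (v * z).norm = z.norm ∧ tau e B (v * z) < tau e B z := by
  have hn : (v * z).norm = z.norm := by have := norm_c' v z; omega
  refine ⟨hn, ?_⟩
  have hs := half_split hv
  have hQz : v⁻¹.toWord.take m = z.toWord.take m := lcp_take _ _ _ (by rw [← hc]; rfl)
  have hPl : (v.toWord.take m).length = m := by
    have : v.toWord.length = 2 * m := hv
    simp; omega
  have hQl : (v⁻¹.toWord.take m).length = m := by
    have : v⁻¹.toWord.length = 2 * m := by rw [← hv, ← norm_inv_eq]; rfl
    simp only [List.length_take]; omega
  generalize hP : v.toWord.take m = P at *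
  generalize hQ : v⁻¹.toWord.take m = Q at *
  have hzw : z.toWord = Q ++ z.toWord.drop m := by rw [hQz, List.take_append_drop]
  have hzl : z.toWord.length = z.norm := rfl
  generalize hA : z.toWord.drop m = A at *
  have hAl : A.length = z.norm - m := by rw [← hA, List.length_drop, hzl]
  have hvz : v * z = mk (P ++ A) := by
    conv_lhs => rw [hs, ← mk_toWord (x := z), hzw, ← mul_mk]
    rw [← mul_mk]; group
  have hvzw : (v * z).toWord = P ++ A := by
    have hred : Red (P ++ A) (reduce (P ++ A)) := reduce.red
    rw [hvz, toWord_mk]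
    apply hred.sublist.eq_of_length
    have : (reduce (P ++ A)).length = (v * z).norm := by rw [hvz]; rfl
    rw [this, hn, List.length_append]; omega
  unfold tau
  rw [toWord_inv, toWord_inv, hvzw, hzw, invRev_append, invRev_append]
  have key : ∀ R : List (α × Bool), R.length = m →
      hf e B (R ++ A) = rk e B (A.take ((z.norm + 1) / 2 - m)) +
        B ^ (A.take ((z.norm + 1) / 2 - m)).length * rk e B R := by
    intro R hR
    unfold hf
    rw [← rk_append, List.length_append, List.take_append, hR, hAl,
      show m + (z.norm - m) = z.norm by omega, List.take_of_length_le (by omega)]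
  have key2 : ∀ R : List (α × Bool), R.length = m →
      hf e B (invRev A ++ invRev R) = rk e B ((invRev A).take ((z.norm + 1) / 2)) := by
    intro R hR
    unfold hf
    rw [List.length_append, invRev_length, invRev_length, hR, hAl,
      show (z.norm - m) + m = z.norm by omega,
      List.take_append_of_le_length (by rw [invRev_length]; omega)]
  rw [key P hPl, key Q hQl, key2 P hPl, key2 Q hQl]
  have : B ^ (A.take ((z.norm + 1) / 2 - m)).length * rk e B P <
      B ^ (A.take ((z.norm + 1) / 2 - m)).length * rk e B Q :=
    Nat.mul_lt_mul_of_pos_left h (by positivity)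
  omega

/-- products along a list without cancelling neighbours -/
inductive Rd (V : Set (FreeGroup α)) : ℕ → FreeGroup α → FreeGroup α → Prop
  | base (v) (hv : v ∈ V) : Rd V 1 v v
  | step (k v w z) (h : Rd V k v w) (hz : z ∈ V) (hvz : v * z ≠ 1) : Rd V (k + 1) z (w * z)

theorem Rd.mem {V : Set (FreeGroup α)} {k : ℕ} {v w : FreeGroup α} (h : Rd V k v w) : v ∈ V := by
  cases h <;> assumption

theorem exists_rd {V : Set (FreeGroup α)} (hinv : ∀ v ∈ V, v⁻¹ ∈ V) {x : FreeGroup α}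
    (hx : x ∈ Subgroup.closure V) : x = 1 ∨ ∃ k v, Rd V k v x := by
  have hstep : ∀ x y : FreeGroup α, y ∈ V → (x = 1 ∨ ∃ k v, Rd V k v x) →
      (x * y = 1 ∨ ∃ k v, Rd V k v (x * y)) := by
    rintro x y hy (rfl | ⟨k, v, h⟩)
    · right; rw [one_mul]; exact ⟨1, y, Rd.base y hy⟩
    · by_cases hvy : v * y = 1
      · cases h with
        | base _ hv => exact Or.inl hvy
        | step k v' w _ h' hz hne =>
          right
          rw [mul_assoc, hvy, mul_one]
          exact ⟨_, _, h'⟩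
      · exact Or.inr ⟨k + 1, y, Rd.step k v x y h hy hvy⟩
  induction hx using Subgroup.closure_induction_right with
  | one => exact Or.inl rfl
  | mul_right x hx y hy ih => exact hstep x y hy ih
  | mul_inv_cancel x hx y hy ih => exact hstep x _ (hinv y hy) ih

theorem nielsen {e : α × Bool → ℕ} {B : ℕ} (hB : 1 < B) (he : Function.Injective e)
    (hlt : ∀ a, e a < B) {V : Set (FreeGroup α)} (hinv : ∀ v ∈ V, v⁻¹ ∈ V) (h1 : 1 ∉ V)
    (H : ∀ a ∈ V, ∀ b ∈ V, a = b ∨ a * b = 1 ∨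
      (b.norm ≤ (a * b).norm ∧ ((a * b).norm = b.norm → tau e B b ≤ tau e B (a * b))))
    {x : FreeGroup α} (hx : x ∈ Subgroup.closure V) (hx1 : x.norm = 1) : x ∈ V := by
  have hne : ∀ v ∈ V, v ≠ 1 := fun v hv h => h1 (h ▸ hv)
  have hpos : ∀ v ∈ V, 0 < v.norm := fun v hv =>
    Nat.pos_of_ne_zero (by simpa [FreeGroup.norm_eq_zero] using hne v hv)
  -- first Nielsen condition
  have N1 : ∀ v ∈ V, ∀ w ∈ V, v * w ≠ 1 → 2 * c v⁻¹ w ≤ v.norm := by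
    intro v hv w hw hvw
    rcases H v hv w hw with rfl | h | ⟨h, _⟩
    · exact (c_sq v (hne v hv)).le
    · exact absurd h hvw
    · have := norm_c' v w; omega
  have N1' : ∀ v ∈ V, ∀ w ∈ V, v * w ≠ 1 → 2 * c v⁻¹ w ≤ w.norm := by
    intro v hv w hw hvw
    have := N1 w⁻¹ (hinv w hw) v⁻¹ (hinv v hv) (by
      rw [← mul_inv_rev]; exact fun h => hvw (inv_eq_one.1 h))
    rw [inv_inv, norm_inv_eq, c_comm] at this
    exact this
  have N2 : ∀ u ∈ V, ∀ v ∈ V, ∀ w ∈ V, u * v ≠ 1 → v * w ≠ 1 →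
      c u⁻¹ v + c v⁻¹ w < v.norm := by
    intro u hu v hv w hw huv hvw
    have a1 := N1' u hu v hv huv
    have a2 := N1 v hv w hw hvw
    have a3 := N1 u hu v hv huv
    have a4 := N1' v hv w hw hvw
    by_contra hcon
    obtain ⟨m, hm⟩ : ∃ m, m = c u⁻¹ v := ⟨_, rfl⟩
    have b1 : v.norm = 2 * m := by omega
    have b2 : c v⁻¹ w = m := by omega
    have b3 : v⁻¹.norm = 2 * m := by rw [norm_inv_eq, b1]
    have b4 : c v⁻¹⁻¹ u⁻¹ = m := by rw [inv_inv, c_comm, hm]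
    rcases lt_trichotomy (rk e B (v.toWord.take m)) (rk e B (v⁻¹.toWord.take m)) with h | h | h
    · obtain ⟨d1, d2⟩ := tau_lt hB b1 b2 (by omega) h
      rcases H v hv w hw with rfl | h' | ⟨_, h'⟩
      · have := c_sq v (hne v hv); omega
      · exact hvw h'
      · have := h' d1; omega
    · apply hne v hv
      have hl : (v.toWord.take m).length = (v⁻¹.toWord.take m).length := by
        have : v.toWord.length = v⁻¹.toWord.length := by simp [toWord_inv]
        rw [List.length_take, List.length_take, this]
      have := rk_inj hB he hlt hl h
      rw [half_split b1, this, mul_inv_cancel]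
    · obtain ⟨d1, d2⟩ := tau_lt hB b3 b4 (by rw [norm_inv_eq]; omega) (by rwa [inv_inv])
      rcases H v⁻¹ (hinv v hv) u⁻¹ (hinv u hu) with h' | h' | ⟨_, h'⟩
      · have h'' : v = u := inv_injective h'
        subst h''
        have := c_sq v (hne v hv); omega
      · apply huv
        rw [← mul_inv_rev] at h'; exact inv_eq_one.1 h'
      · have := h' d1; omega
  have inv : ∀ k v w, Rd V k v w → ∀ z ∈ V, v * z ≠ 1 →
      c v⁻¹ z < c w⁻¹ v⁻¹ ∧ k + c v⁻¹ z ≤ w.norm := by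
    intro k v w h
    induction h with
    | base v hv =>
      intro z hz hvz
      rw [c_self, norm_inv_eq]
      have := N1 v hv z hz hvz
      have := hpos v hv
      omega
    | step k v w z h hz hvz ih =>
      intro y hy hzy
      obtain ⟨i1, i2⟩ := ih z hz hvz
      have n2 := N2 v h.mem z hz y hy hvz hzy
      have u1 := c_ultra w⁻¹ z v⁻¹
      have u2 := c_ultra v⁻¹ z w⁻¹
      rw [c_comm v⁻¹ w⁻¹] at u2
      have e1 : c w⁻¹ z = c v⁻¹ z := by omega
      have l1 := norm_c' w z
      have l2 := norm_c (w * z)⁻¹ z⁻¹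
      have e2 : (w * z)⁻¹⁻¹ * z⁻¹ = w := by group
      rw [e2, norm_inv_eq, norm_inv_eq] at l2
      have n1 := N1' v h.mem z hz hvz
      omega
  rcases exists_rd hinv hx with rfl | ⟨k, v, h⟩
  · simp at hx1
  · have hv := h.mem
    have hvv : v * v ≠ 1 := by
      intro h'
      have := c_sq v (hne v hv)
      have := norm_c' v v
      rw [h'] at this
      have := hpos v hv
      simp at *
      omega
    have := (inv k v x h v hv hvv).2
    cases h with
    | base => exact hv
    | step k v' w _ h' hz hne =>
      cases h' <;> omega

end rank

end ACN

namespace ACN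

open Relation

theorem sum_update_lt {n : ℕ} {G : Type} (f : G → ℕ) (t : Fin n → G) (j : Fin n) (g : G) :
    ∑ k, f (Function.update t j g k) + f (t j) = ∑ k, f (t k) + f g := by
  have h1 := Finset.add_sum_erase Finset.univ (fun k => f (Function.update t j g k))
    (Finset.mem_univ j)
  have h2 := Finset.add_sum_erase Finset.univ (fun k => f (t k)) (Finset.mem_univ j)
  have h3 : ∑ k ∈ Finset.univ.erase j, f (Function.update t j g k) =
      ∑ k ∈ Finset.univ.erase j, f (t k) := by
    apply Finset.sum_congr rfl
    intro k hk
    rw [Function.update_of_ne (Finset.ne_of_mem_erase hk)]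
  simp only [Function.update_self] at h1
  omega

theorem reach_std {n : ℕ} (u : Fin n → FreeGroup (Fin n))
    (hu : Subgroup.closure (Set.range u) = ⊤) : Reach n u (fun i => FreeGroup.of i) := by
  classical
  set e : Fin n × Bool → ℕ := fun a => 2 * a.1.val + a.2.toNat with he
  set B := 2 * n + 2 with hBdef
  have hB : 1 < B := by omega
  have hinj : Function.Injective e := by
    rintro ⟨a, b⟩ ⟨a', b'⟩ h
    simp only [he] at h
    cases b <;> cases b' <;> simp at h ⊢ <;> omega
  have hlt : ∀ a, e a < B := by
    rintro ⟨a, b⟩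
    have := a.isLt
    simp only [he]
    cases b <;> simp <;> omega
  let S : Set (Fin n → FreeGroup (Fin n)) :=
    {t | Reach n u t ∧ Subgroup.closure (Set.range t) = ⊤}
  let μ : (Fin n → FreeGroup (Fin n)) → ℕ ×ₗ ℕ :=
    fun t => toLex (∑ k, (t k).norm, ∑ k, tau e B (t k))
  have hS : S.Nonempty := ⟨u, ReflTransGen.refl, hu⟩
  obtain ⟨t, ⟨htr, htg⟩, hmin⟩ : ∃ t ∈ S, ∀ s ∈ S, ¬ μ s < μ t := by
    have wf : WellFounded (fun a b => μ a < μ b) := InvImage.wf μ wellFounded_lt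
    exact ⟨wf.min S hS, wf.min_mem S hS, fun s hs => wf.not_lt_min S hs⟩
  have hmin' : ∀ i j, j ≠ i → ∀ a b, (a = t i ∨ a = (t i)⁻¹) → (b = t j ∨ b = (t j)⁻¹) →
      b.norm ≤ (a * b).norm ∧ ((a * b).norm = b.norm → tau e B b ≤ tau e B (a * b)) := by
    intro i j hij a b ha hb
    have hr := reach_mul' t hij a⁻¹ b⁻¹
      (by rcases ha with rfl | rfl <;> simp) (by rcases hb with rfl | rfl <;> simp)
    set g := b⁻¹ * a⁻¹ with hg
    have hgab : g⁻¹ = a * b := by rw [hg]; group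
    have hmem : Function.update t j g ∈ S := by
      refine ⟨htr.trans hr, ?_⟩
      rw [eq_top_iff, ← htg, Subgroup.closure_le]
      set C := Subgroup.closure (Set.range (Function.update t j g)) with hC
      have hin : ∀ k, Function.update t j g k ∈ C := fun k => Subgroup.subset_closure ⟨k, rfl⟩
      have hi : t i ∈ C := by simpa [hij.symm] using hin i
      have hgC : g ∈ C := by simpa using hin j
      have haC : a ∈ C := by rcases ha with rfl | rfl <;> simpa using hi
      have hbC : b ∈ C := by
        have : b = a⁻¹ * g⁻¹ := by rw [hgab]; group
        rw [this]; exact mul_mem (inv_mem haC) (inv_mem hgC)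
      have hj : t j ∈ C := by rcases hb with rfl | rfl <;> simpa using hbC
      rintro _ ⟨k, rfl⟩
      by_cases hk : k = j
      · subst hk; exact hj
      · simpa [hk] using hin k
    have hnot := hmin _ hmem
    have s1 := sum_update_lt FreeGroup.norm t j g
    have s2 := sum_update_lt (tau e B) t j g
    have e1 : (a * b).norm = g.norm := by rw [← hgab, FreeGroup.norm_inv_eq]
    have e2 : tau e B (a * b) = tau e B g := by rw [← hgab, tau_inv]
    have e3 : b.norm = (t j).norm := by
      rcases hb with rfl | rfl <;> simp [FreeGroup.norm_inv_eq]
    have e4 : tau e B b = tau e B (t j) := by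
      rcases hb with rfl | rfl <;> simp [tau_inv]
    rw [e1, e2, e3, e4]
    rw [Prod.Lex.toLex_lt_toLex] at hnot
    push Not at hnot
    obtain ⟨n1, n2⟩ := hnot
    refine ⟨by omega, fun h => ?_⟩
    have := n2 (by omega)
    omega
  let V : Set (FreeGroup (Fin n)) := {v | v ≠ 1 ∧ ∃ i, v = t i ∨ v = (t i)⁻¹}
  have hVinv : ∀ v ∈ V, v⁻¹ ∈ V := by
    rintro v ⟨hv, i, rfl | rfl⟩
    · exact ⟨by simpa using hv, i, Or.inr rfl⟩
    · exact ⟨by simpa using hv, i, Or.inl (inv_inv _)⟩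
  have hV1 : (1 : FreeGroup (Fin n)) ∉ V := fun h => h.1 rfl
  have hVH : ∀ a ∈ V, ∀ b ∈ V, a = b ∨ a * b = 1 ∨
      (b.norm ≤ (a * b).norm ∧ ((a * b).norm = b.norm → tau e B b ≤ tau e B (a * b))) := by
    rintro a ⟨_, i, ha⟩ b ⟨_, j, hb⟩
    by_cases hij : j = i
    · subst hij
      rcases ha with rfl | rfl <;> rcases hb with rfl | rfl <;> simp
    · exact Or.inr (Or.inr (hmin' i j hij a b ha hb))
  have hVtop : Subgroup.closure V = ⊤ := by
    rw [eq_top_iff, ← htg, Subgroup.closure_le]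
    rintro _ ⟨k, rfl⟩
    by_cases hk : t k = 1
    · rw [hk]; exact one_mem _
    · exact Subgroup.subset_closure ⟨hk, k, Or.inl rfl⟩
  have hfind : ∀ i, ∃ j, FreeGroup.of i = t j ∨ FreeGroup.of i = (t j)⁻¹ := fun i =>
    (nielsen hB hinj hlt hVinv hV1 hVH (x := FreeGroup.of i) (by rw [hVtop]; trivial)
      (FreeGroup.norm_of i)).2
  choose σ hσ using hfind
  have hσinj : Function.Injective σ := by
    intro i i' h
    have h1 := hσ i
    have h2 := hσ i'
    rw [← h] at h2
    have h3 : FreeGroup.of i = FreeGroup.of i' ∨ FreeGroup.of i = (FreeGroup.of i')⁻¹ := by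
      rcases h1 with h1 | h1 <;> rcases h2 with h2 | h2 <;> simp [h1, h2]
    rcases h3 with h3 | h3
    · exact FreeGroup.of_injective h3
    · have := congrArg FreeGroup.toWord h3
      simp [FreeGroup.toWord_inv, FreeGroup.invRev] at this
  have hσb : Function.Bijective σ := Finite.injective_iff_bijective.1 hσinj
  let p : Equiv.Perm (Fin n) := Equiv.ofBijective σ hσb
  refine htr.trans ((reach_perm p t).trans (reach_signs _ _ ?_))
  intro i
  exact hσ i

theorem closure_auto {n : ℕ} (ψ : FreeGroup (Fin n) ≃* FreeGroup (Fin n)) :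
    Subgroup.closure (Set.range (fun i => ψ (FreeGroup.of i))) = ⊤ := by
  have h : Set.range (fun i => ψ (FreeGroup.of i)) =
      ψ.toMonoidHom '' Set.range (FreeGroup.of : Fin n → _) := by
    rw [← Set.range_comp]; rfl
  rw [h, ← MonoidHom.map_closure, FreeGroup.closure_range_of]
  exact Subgroup.map_top_of_surjective _ ψ.surjective

end ACN

/-- If a balanced presentation can be converted to the trivial presentation by a finite
sequence of moves of types (1), (2), (3) and (5), then it can be converted to the trivial
presentation by a finite sequence of moves of types (1), (2) and (3) alone. -/
theorem trivializable_of_moves1235 (n : ℕ) (r : Fin n → FreeGroup (Fin n))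
    (h : Relation.ReflTransGen (Move1235 n) r (fun i => FreeGroup.of i)) :
    Relation.ReflTransGen (Move123 n) r (fun i => FreeGroup.of i) := by
  induction h using Relation.ReflTransGen.head_induction_on with
  | refl => exact Relation.ReflTransGen.refl
  | head hm _ ih =>
    cases hm with
    | inv i => exact Relation.ReflTransGen.head (Move123.inv _ i) ih
    | mul i j hij => exact Relation.ReflTransGen.head (Move123.mul _ i j hij) ih
    | conj i j => exact Relation.ReflTransGen.head (Move123.conj _ i j) ih
    | conjInv i j => exact Relation.ReflTransGen.head (Move123.conjInv _ i j) ih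
    | auto ψ =>
      have h1 := ACN.reach_map ψ.symm ih
      simp only [MulEquiv.symm_apply_apply] at h1
      exact h1.trans (ACN.reach_std _ (ACN.closure_auto ψ.symm))
end

section
/- If a balanced presentation P can be converted to the trivial presentation by a finite sequence of moves of types (1)–(5) (i.e., P is Q**-equivalent to the trivial presentation), then P can be converted to the trivial presentation by a finite sequence of moves of types (1)–(4) alone (i.e., P is AC-trivial). -/
/-- Andrews-Curtis moves (1)-(4) on balanced presentations, where a balanced
presentation with `n` generators is a tuple of `n` relators in `FreeGroup (Fin n)`.
`inv` is move (1), `mul` is move (2), `conj`/`conjInv` are move (3) (conjugation by a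
generator or its inverse), and `stab`/`destab` are the two directions of move (4). -/
inductive ACMove :
    (Σ n : ℕ, Fin n → FreeGroup (Fin n)) → (Σ n : ℕ, Fin n → FreeGroup (Fin n)) → Prop
  | inv (n : ℕ) (r : Fin n → FreeGroup (Fin n)) (i : Fin n) :
      ACMove ⟨n, r⟩ ⟨n, Function.update r i (r i)⁻¹⟩
  | mul (n : ℕ) (r : Fin n → FreeGroup (Fin n)) (i j : Fin n) (hij : i ≠ j) :
      ACMove ⟨n, r⟩ ⟨n, Function.update r i (r i * r j)⟩
  | conj (n : ℕ) (r : Fin n → FreeGroup (Fin n)) (i j : Fin n) :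
      ACMove ⟨n, r⟩ ⟨n, Function.update r i (FreeGroup.of j * r i * (FreeGroup.of j)⁻¹)⟩
  | conjInv (n : ℕ) (r : Fin n → FreeGroup (Fin n)) (i j : Fin n) :
      ACMove ⟨n, r⟩ ⟨n, Function.update r i ((FreeGroup.of j)⁻¹ * r i * FreeGroup.of j)⟩
  | stab (n : ℕ) (r : Fin n → FreeGroup (Fin n)) :
      ACMove ⟨n, r⟩
        ⟨n + 1, Fin.snoc (fun i => FreeGroup.map Fin.castSucc (r i)) (FreeGroup.of (Fin.last n))⟩
  | destab (n : ℕ) (r : Fin n → FreeGroup (Fin n)) :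
      ACMove
        ⟨n + 1, Fin.snoc (fun i => FreeGroup.map Fin.castSucc (r i)) (FreeGroup.of (Fin.last n))⟩
        ⟨n, r⟩

/-- Two balanced presentations are AC-equivalent if they are related by a finite
sequence of Andrews-Curtis moves (1)-(4). -/
def ACEquiv (P Q : Σ n : ℕ, Fin n → FreeGroup (Fin n)) : Prop :=
  Relation.ReflTransGen ACMove P Q

/-- A balanced presentation is AC-trivial if it can be converted to the trivial
presentation `(x_1, …, x_n)` by a finite sequence of moves (1)-(4). -/
def ACTrivial {n : ℕ} (r : Fin n → FreeGroup (Fin n)) : Prop :=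
  ACEquiv ⟨n, r⟩ ⟨n, fun i => FreeGroup.of i⟩

/-- Moves (1)-(5) on balanced presentations: the Andrews-Curtis moves together with
move (5), `auto`, which applies an automorphism of the free group to every relator. -/
inductive QMove :
    (Σ n : ℕ, Fin n → FreeGroup (Fin n)) → (Σ n : ℕ, Fin n → FreeGroup (Fin n)) → Prop
  | inv (n : ℕ) (r : Fin n → FreeGroup (Fin n)) (i : Fin n) :
      QMove ⟨n, r⟩ ⟨n, Function.update r i (r i)⁻¹⟩
  | mul (n : ℕ) (r : Fin n → FreeGroup (Fin n)) (i j : Fin n) (hij : i ≠ j) :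
      QMove ⟨n, r⟩ ⟨n, Function.update r i (r i * r j)⟩
  | conj (n : ℕ) (r : Fin n → FreeGroup (Fin n)) (i j : Fin n) :
      QMove ⟨n, r⟩ ⟨n, Function.update r i (FreeGroup.of j * r i * (FreeGroup.of j)⁻¹)⟩
  | conjInv (n : ℕ) (r : Fin n → FreeGroup (Fin n)) (i j : Fin n) :
      QMove ⟨n, r⟩ ⟨n, Function.update r i ((FreeGroup.of j)⁻¹ * r i * FreeGroup.of j)⟩
  | stab (n : ℕ) (r : Fin n → FreeGroup (Fin n)) :
      QMove ⟨n, r⟩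
        ⟨n + 1, Fin.snoc (fun i => FreeGroup.map Fin.castSucc (r i)) (FreeGroup.of (Fin.last n))⟩
  | destab (n : ℕ) (r : Fin n → FreeGroup (Fin n)) :
      QMove
        ⟨n + 1, Fin.snoc (fun i => FreeGroup.map Fin.castSucc (r i)) (FreeGroup.of (Fin.last n))⟩
        ⟨n, r⟩
  | auto (n : ℕ) (r : Fin n → FreeGroup (Fin n)) (ψ : FreeGroup (Fin n) ≃* FreeGroup (Fin n)) :
      QMove ⟨n, r⟩ ⟨n, fun i => ψ (r i)⟩


namespace QAC
open Relation
set_option linter.unusedSectionVars false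

section Generic
variable {ι α β : Type} [DecidableEq ι]

inductive Mv : (ι → FreeGroup α) → (ι → FreeGroup α) → Prop
  | inv (r : ι → FreeGroup α) (i : ι) : Mv r (Function.update r i (r i)⁻¹)
  | mul (r : ι → FreeGroup α) (i j : ι) (hij : i ≠ j) : Mv r (Function.update r i (r i * r j))
  | conj (r : ι → FreeGroup α) (i : ι) (a : α) :
      Mv r (Function.update r i (FreeGroup.of a * r i * (FreeGroup.of a)⁻¹))
  | conjInv (r : ι → FreeGroup α) (i : ι) (a : α) :
      Mv r (Function.update r i ((FreeGroup.of a)⁻¹ * r i * FreeGroup.of a))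

def Eqv (r s : ι → FreeGroup α) : Prop := ReflTransGen Mv r s

theorem Eqv.refl (r : ι → FreeGroup α) : Eqv r r := ReflTransGen.refl
theorem Eqv.trans {r s t : ι → FreeGroup α} (h : Eqv r s) (h' : Eqv s t) : Eqv r t :=
  ReflTransGen.trans h h'
theorem Mv.eqv {r s : ι → FreeGroup α} (h : Mv r s) : Eqv r s := ReflTransGen.single h

theorem Eqv.inv (r : ι → FreeGroup α) (i : ι) : Eqv r (Function.update r i (r i)⁻¹) :=
  (Mv.inv r i).eqv

theorem Eqv.mul (r : ι → FreeGroup α) (i j : ι) (hij : i ≠ j) :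
    Eqv r (Function.update r i (r i * r j)) := (Mv.mul r i j hij).eqv

/-- chain two updates at the same index -/
theorem Eqv.upd {r : ι → FreeGroup α} {i : ι} {c d : FreeGroup α}
    (h : Eqv r (Function.update r i c))
    (h' : Eqv (Function.update r i c) (Function.update (Function.update r i c) i d)) :
    Eqv r (Function.update r i d) := by
  rw [Function.update_idem] at h'
  exact h.trans h'

theorem Eqv.mulInv (r : ι → FreeGroup α) (i j : ι) (hij : i ≠ j) :
    Eqv r (Function.update r i (r i * (r j)⁻¹)) := by
  have h1 := Eqv.inv r j
  have h2 := Eqv.mul (Function.update r j (r j)⁻¹) i j hij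
  have h3 := Eqv.inv (Function.update (Function.update r j (r j)⁻¹) i
    (r i * (r j)⁻¹)) j
  simp only [Function.update_self, Function.update_of_ne hij, Function.update_of_ne hij.symm,
    inv_inv] at h2 h3
  rw [Function.update_comm hij, Function.update_idem] at h3
  have e : Function.update r j (r j) = r := Function.update_eq_self _ _
  rw [e] at h3
  exact (h1.trans h2).trans h3

theorem Mv.symm {r s : ι → FreeGroup α} (h : Mv r s) : Eqv s r := by
  cases h with
  | inv i => 
    have := Eqv.inv (Function.update r i (r i)⁻¹) i
    simpa using this
  | mul i j hij =>
    have := Eqv.mulInv (Function.update r i (r i * r j)) i j hij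
    simpa [Function.update_of_ne hij.symm] using this
  | conj i a =>
    have := (Mv.conjInv (Function.update r i (FreeGroup.of a * r i * (FreeGroup.of a)⁻¹)) i a).eqv
    simpa [mul_assoc] using this
  | conjInv i a =>
    have := (Mv.conj (Function.update r i ((FreeGroup.of a)⁻¹ * r i * FreeGroup.of a)) i a).eqv
    simpa [mul_assoc] using this

theorem Eqv.symm {r s : ι → FreeGroup α} (h : Eqv r s) : Eqv s r := by
  induction h with
  | refl => exact Eqv.refl _
  | tail _ h ih => exact h.symm.trans ih

theorem Eqv.conj (g : FreeGroup α) : ∀ (r : ι → FreeGroup α) (i : ι),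
    Eqv r (Function.update r i (g * r i * g⁻¹)) := by
  induction g using FreeGroup.induction_on with
  | C1 => intro r i; simpa using Eqv.refl r
  | of a => intro r i; exact (Mv.conj r i a).eqv
  | inv_of a _ => intro r i; simpa using (Mv.conjInv r i a).eqv
  | mul x y hx hy =>
    intro r i
    refine (hy r i).upd ?_
    have := hx (Function.update r i (y * r i * y⁻¹)) i
    simpa [mul_assoc] using this

theorem Eqv.mulConj (r : ι → FreeGroup α) (i j : ι) (hij : i ≠ j) (g : FreeGroup α) :
    Eqv r (Function.update r i (r i * (g * r j * g⁻¹))) := by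
  have h1 := Eqv.conj g⁻¹ r i
  refine h1.upd ?_
  refine (Eqv.mul _ i j hij).trans ?_
  have := Eqv.conj g (Function.update r i (g⁻¹ * r i * g * r j)) i
  simpa [mul_assoc, Function.update_of_ne hij.symm] using this

theorem Eqv.mulConjInv (r : ι → FreeGroup α) (i j : ι) (hij : i ≠ j) (g : FreeGroup α) :
    Eqv r (Function.update r i (r i * (g * (r j)⁻¹ * g⁻¹))) := by
  have h1 := Eqv.conj g⁻¹ r i
  refine h1.upd ?_
  refine (Eqv.mulInv _ i j hij).trans ?_
  have := Eqv.conj g (Function.update r i (g⁻¹ * r i * g * (r j)⁻¹)) i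
  simpa [mul_assoc, Function.update_of_ne hij.symm] using this

/-- normal closure of the other relators -/
def Oth (r : ι → FreeGroup α) (S : Set ι) : Subgroup (FreeGroup α) :=
  Subgroup.normalClosure (r '' Sᶜ)

instance (r : ι → FreeGroup α) (S : Set ι) : (Oth r S).Normal := by
  unfold Oth; infer_instance

def pr (r : ι → FreeGroup α) (S : Set ι) : FreeGroup α →* FreeGroup α ⧸ Oth r S :=
  QuotientGroup.mk' _

theorem pr_eq_one (r : ι → FreeGroup α) (S : Set ι) {j : ι} (h : j ∉ S) : pr r S (r j) = 1 := by
  refine (QuotientGroup.eq_one_iff _).2 (Subgroup.subset_normalClosure ⟨j, h, rfl⟩)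

theorem Eqv.mulMem (r : ι → FreeGroup α) (i : ι) {c : FreeGroup α} (hc : c ∈ Oth r {i}) :
    Eqv r (Function.update r i (r i * c)) := by
  have key : ∀ c ∈ Oth r {i}, ∀ s : ι → FreeGroup α, (∀ j, j ≠ i → s j = r j) →
      Eqv s (Function.update s i (s i * c)) := by
    intro c hc
    unfold Oth Subgroup.normalClosure at hc
    induction hc using Subgroup.closure_induction with
    | mem x hx =>
      intro s hs
      rw [Group.mem_conjugatesOfSet_iff] at hx
      obtain ⟨y, ⟨j, hj, rfl⟩, hy⟩ := hx
      obtain ⟨g, rfl⟩ := isConj_iff.1 hy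
      have hj : j ≠ i := by simpa using hj
      rw [← hs j hj]
      exact Eqv.mulConj s i j hj.symm g
    | one => intro s hs; simpa using Eqv.refl s
    | mul x y _ _ hx hy =>
      intro s hs
      refine (hx s hs).upd ?_
      have := hy (Function.update s i (s i * x)) (fun j hj => by simp [hj, hs])
      simpa [mul_assoc] using this
    | inv x _ hx =>
      intro s hs
      have := hx (Function.update s i (s i * x⁻¹)) (fun j hj => by simp [hj, hs])
      simpa using this.symm
  exact key c hc r (fun _ _ => rfl)

theorem Eqv.change (r : ι → FreeGroup α) (i : ι) (s : FreeGroup α)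
    (h : pr r {i} (r i) = pr r {i} s) : Eqv r (Function.update r i s) := by
  have : (r i)⁻¹ * s ∈ Oth r {i} := QuotientGroup.eq.1 h
  simpa using Eqv.mulMem r i this

theorem Eqv.changeInv (r : ι → FreeGroup α) (i : ι) (s : FreeGroup α)
    (h : pr r {i} (r i) = (pr r {i} s)⁻¹) : Eqv r (Function.update r i s) := by
  rw [← map_inv] at h
  refine (Eqv.change r i _ h).upd ?_
  have := Eqv.inv (Function.update r i s⁻¹) i
  simpa using this

theorem Eqv.hom {r s : ι → FreeGroup α} (h : Eqv r s) (φ : FreeGroup α →* FreeGroup β) :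
    Eqv (fun i => φ (r i)) (fun i => φ (s i)) := by
  have hu : ∀ (r : ι → FreeGroup α) (i : ι) (c : FreeGroup α),
      (fun k => φ (Function.update r i c k)) = Function.update (fun k => φ (r k)) i (φ c) := by
    intro r i c; funext k; by_cases hk : k = i
    · subst hk; simp
    · simp [hk]
  induction h with
  | refl => exact Eqv.refl _
  | @tail b _ _ h ih =>
    refine ih.trans ?_
    cases h with
    | inv i => rw [hu, map_inv]; exact Eqv.inv _ _
    | mul i j hij => rw [hu, map_mul]; exact Eqv.mul _ _ _ hij
    | conj i a => rw [hu, map_mul, map_mul, map_inv]; exact Eqv.conj _ _ _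
    | conjInv i a =>
      rw [hu, map_mul, map_mul, map_inv]
      have := Eqv.conj (φ (FreeGroup.of a))⁻¹ (fun k => φ (b k)) i
      rw [inv_inv] at this
      exact this

theorem Eqv.swap (r : ι → FreeGroup α) (i j : ι) (hij : i ≠ j) :
    Eqv r (r ∘ Equiv.swap i j) := by
  have h1 := Eqv.mul r i j hij
  have h2 := Eqv.mulInv (Function.update r i (r i * r j)) j i hij.symm
  have h2' := Eqv.inv (Function.update (Function.update r i (r i * r j)) j (r j * (r i * r j)⁻¹)) j
  have h3 := Eqv.mulConjInv (Function.update (Function.update r i (r i * r j)) j (r i)) i j hij (r j)⁻¹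
  have e : Function.update (Function.update (Function.update r i (r i * r j)) j (r i)) i (r j)
      = r ∘ Equiv.swap i j := by
    funext k
    by_cases hi : k = i
    · subst hi; simp
    · by_cases hj : k = j
      · subst hj; simp [hi]
      · simp [hi, hj, Equiv.swap_apply_of_ne_of_ne]
  simp only [Function.update_self, Function.update_idem, Function.update_of_ne hij.symm,
    Function.update_of_ne hij] at h1 h2 h2' h3
  have e1 : (r j * (r i * r j)⁻¹)⁻¹ = r i := by group
  have e2 : r i * r j * ((r j)⁻¹ * (r i)⁻¹ * (r j)⁻¹⁻¹) = r j := by group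
  rw [e1] at h2'
  rw [e2, e] at h3
  exact ((h1.trans h2).trans h2').trans h3

theorem Eqv.perm (r : ι → FreeGroup α) (σ : Equiv.Perm ι) (hσ : {x | σ x ≠ x}.Finite) :
    Eqv r (r ∘ σ) := by
  have : σ ∈ Subgroup.closure {σ : Equiv.Perm ι | σ.IsSwap} := by
    rw [_root_.mem_closure_isSwap']
    exact hσ
  clear hσ
  induction this using Subgroup.closure_induction generalizing r with
  | mem x hx => obtain ⟨i, j, hij, rfl⟩ := hx; exact Eqv.swap r i j hij
  | one => exact Eqv.refl r
  | mul x y _ _ hx hy => exact (hx r).trans (hy (r ∘ x))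
  | inv x _ hx => 
    have := hx (r ∘ (x⁻¹ : Equiv.Perm ι))
    have e : (r ∘ (x⁻¹ : Equiv.Perm ι)) ∘ x = r := by funext k; simp
    rw [e] at this
    exact this.symm

theorem Eqv.multi (r s : ι → FreeGroup α) (S : Finset ι)
    (h1 : ∀ i ∉ S, s i = r i) (h2 : ∀ i ∈ S, pr r S (r i) = pr r S (s i)) : Eqv r s := by
  have : ∀ T : Finset ι, T ⊆ S → Eqv r (fun i => if i ∈ T then s i else r i) := by
    intro T
    induction T using Finset.induction_on with
    | empty => intro _; simpa using Eqv.refl r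
    | insert a T ha ih =>
      intro hT
      refine (ih (fun x hx => hT (Finset.mem_insert_of_mem hx))).trans ?_
      have haS := hT (Finset.mem_insert_self a T)
      have e : (fun i => if i ∈ insert a T then s i else r i) =
        Function.update (fun i => if i ∈ T then s i else r i) a (s a) := by
        funext k
        by_cases hk : k = a
        · subst hk; simp
        · simp [hk]
      rw [e]
      apply Eqv.change
      simp only [ha, if_false]
      have hm : (r a)⁻¹ * s a ∈ Oth r S := QuotientGroup.eq.1 (h2 a haS)
      refine QuotientGroup.eq.2 ?_
      refine Subgroup.normalClosure_mono ?_ hm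
      rintro _ ⟨j, hj, rfl⟩
      have hj : j ∉ S := by simpa using hj
      refine ⟨j, ?_, ?_⟩
      · simp; rintro rfl; exact hj haS
      · simp; intro hjT; exact absurd (hT (Finset.mem_insert_of_mem hjT)) hj
  have e := this S (fun _ h => h)
  convert e using 1
  funext i
  by_cases hi : i ∈ S
  · simp [hi]
  · simp [hi, h1 i hi]

end Generic

section Graph
variable {A W : Type} [DecidableEq A] [DecidableEq W]

def Triv {α : Type} [DecidableEq α] (r : α → FreeGroup α) : Prop := Eqv r FreeGroup.of

theorem Triv.hom {α : Type} [DecidableEq α] {r : α → FreeGroup α} (h : Triv r)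
    (φ : FreeGroup α →* FreeGroup α) (hφ : Triv (fun i => φ (FreeGroup.of i))) :
    Triv (fun i => φ (r i)) := (Eqv.hom h φ).trans hφ

abbrev Gr (A W : Type) := A ⊕ W → Option W × List (A × Bool) × Option W

def tv (v : Option W) : FreeGroup (A ⊕ W) := v.elim 1 (fun w => FreeGroup.of (Sum.inr w))

def xw (L : List (A × Bool)) : FreeGroup (A ⊕ W) := FreeGroup.map Sum.inl (FreeGroup.mk L)

def edr (E : Option W × List (A × Bool) × Option W) : FreeGroup (A ⊕ W) :=
  tv E.1 * xw E.2.1 * (tv E.2.2)⁻¹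

def rel (G : Gr A W) : A ⊕ W → FreeGroup (A ⊕ W) := fun e => edr (G e)

theorem rel_update (G : Gr A W) (e : A ⊕ W) (E) :
    rel (Function.update G e E) = Function.update (rel G) e (edr E) := by
  funext k; by_cases hk : k = e
  · subst hk; simp [rel]
  · simp [rel, hk]

theorem rel_of {G : Gr A W} {e : A ⊕ W} {u v L} (h : G e = (u, L, v)) :
    rel G e = tv u * xw L * (tv v)⁻¹ := by simp [rel, edr, h]

@[simp] theorem xw_nil : (xw [] : FreeGroup (A ⊕ W)) = 1 := by
  simp [xw, ← FreeGroup.one_eq_mk]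
@[simp] theorem tv_none : (tv none : FreeGroup (A ⊕ W)) = 1 := rfl
@[simp] theorem tv_some (w : W) : (tv (some w) : FreeGroup (A ⊕ W)) = FreeGroup.of (Sum.inr w) := rfl

def FinS (G : Gr A W) : Prop := {w | G (Sum.inr w) ≠ (some w, [], none)}.Finite

theorem FinS.update {G : Gr A W} (h : FinS G) (e E) : FinS (Function.update G e E) := by
  have : {w : W | Sum.inr w = e}.Finite := by
    refine Set.Subsingleton.finite ?_
    rintro a ha b hb
    exact Sum.inr_injective (ha.trans hb.symm)
  refine (Set.Finite.union h this).subset ?_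
  intro w hw
  by_cases hwe : Sum.inr w = e
  · exact Or.inr hwe
  · left
    simpa [Function.update_of_ne hwe] using hw

def Con (G : Gr A W) : Option W → Option W → Prop :=
  Relation.EqvGen (fun u v => ∃ e, G e = (u, [], v))

theorem Con.pr_eq {G : Gr A W} {S : Set (A ⊕ W)} {u v : Option W} (h : Con G u v)
    (hS : ∀ e ∈ S, ∀ u v, G e ≠ (u, [], v)) : pr (rel G) S (tv u) = pr (rel G) S (tv v) := by
  induction h with
  | rel u v h =>
    obtain ⟨e, he⟩ := h
    have := pr_eq_one (rel G) S (j := e) (fun h => hS e h _ _ he)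
    rw [rel_of he] at this
    simpa [mul_inv_eq_one] using this
  | refl => rfl
  | symm _ _ _ ih => exact ih.symm
  | trans _ _ _ _ _ h1 h2 => exact h1.trans h2

theorem final [Finite A] (G : Gr A W) (hf : FinS G) (hr : ∀ w, ∃ e, G e = (some w, [], none))
    (hl : ∀ a, ∃ e u v, G e = (u, [(a, true)], v)) : Triv (rel G) := by
  have hr' : ∀ w, ∃ e, G e = (some w, [], none) ∧
      (G (Sum.inr w) = (some w, [], none) → e = Sum.inr w) := by
    intro w
    by_cases h : G (Sum.inr w) = (some w, [], none)
    · exact ⟨_, h, fun _ => rfl⟩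
    · obtain ⟨e, he⟩ := hr w
      exact ⟨e, he, fun h' => absurd h' h⟩
  choose ew hew hew' using hr'
  choose ea ua va hea using hl
  let f : A ⊕ W → A ⊕ W := Sum.elim ea ew
  have hinj : Function.Injective f := by
    rintro (a | w) (a' | w') h <;> simp only [f, Sum.elim_inl, Sum.elim_inr] at h
    · have := hea a; rw [h, hea a'] at this; simp at this; rw [this.2.1]
    · have := hea a; rw [h, hew w'] at this; simp at this
    · have := hea a'; rw [← h, hew w] at this; simp at this
    · have := hew w; rw [h, hew w'] at this; simp at this; rw [this]
  have hfin : {x | f x ≠ x}.Finite := by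
    refine ((Set.finite_range (Sum.inl : A → A ⊕ W)).union (hf.image Sum.inr)).subset ?_
    rintro (a | w) hx
    · left; simp
    · right
      refine ⟨w, fun h => hx (hew' w h), rfl⟩
  have hsurj : Function.Surjective f := by
    intro y
    by_cases hy : f y = y
    · exact ⟨y, hy⟩
    · have hm : Set.MapsTo f {x | f x ≠ x} {x | f x ≠ x} := fun x hx h => hx (hinj h)
      have := hfin.to_subtype
      have hs := Finite.surjective_of_injective (f := hm.restrict)
        (fun p q h => Subtype.ext (hinj (congrArg Subtype.val h)))
      obtain ⟨x, hx⟩ := hs ⟨y, hy⟩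
      have hx := congrArg Subtype.val hx
      exact ⟨x.1, hx⟩
  let σ : Equiv.Perm (A ⊕ W) := Equiv.ofBijective f ⟨hinj, hsurj⟩
  refine (Eqv.perm (rel G) σ hfin).trans ?_
  have := Fintype.ofFinite A
  have hw : ∀ w, (rel G ∘ σ) (Sum.inr w) = FreeGroup.of (Sum.inr w) := by
    intro w
    change rel G (ew w) = _
    rw [rel_of (hew w)]; simp
  refine Eqv.multi _ _ (Finset.univ.image Sum.inl) ?_ ?_
  · rintro (a | w) h
    · simp at h
    · exact (hw w).symm
  · have ht : ∀ v : Option W, pr (rel G ∘ σ) ((Finset.univ.image Sum.inl : Finset (A ⊕ W)) : Set (A ⊕ W)) (tv v) = 1 := by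
      rintro (_ | w)
      · simp
      · rw [tv_some, ← hw w]
        exact pr_eq_one _ _ (by simp)
    rintro (a | w) h
    · have : (rel G ∘ σ) (Sum.inl a) = tv (ua a) * FreeGroup.of (Sum.inl a) * (tv (va a))⁻¹ := by
        change rel G (ea a) = _
        rw [rel_of (hea a)]; rfl
      rw [this, map_mul, map_mul, map_inv, ht, ht]; simp
    · simp at h

/-- edgewise comparison for `Con` -/
theorem Con.mono {G G' : Gr A W} {u v : Option W} (h : Con G u v)
    (hG : ∀ e u v, G e = (u, [], v) → Con G' u v) : Con G' u v := by
  induction h with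
  | rel u v h => obtain ⟨e, he⟩ := h; exact hG e _ _ he
  | refl => exact Relation.EqvGen.refl _
  | symm _ _ _ ih => exact ih.symm
  | trans _ _ _ _ _ h1 h2 => exact h1.trans _ _ _ h2

def Rooted (G : Gr A W) (v : Option W) : Prop := v = none ∨ ∃ w, v = some w ∧ ∃ e, G e = (some w, [], none)

theorem root_step {G : Gr A W} {u v : Option W} (h : Con G u v) (hne : ¬ (Rooted G u ↔ Rooted G v)) :
    ∃ e z y, (G e = (z, [], some y) ∨ G e = (some y, [], z)) ∧ Rooted G z ∧ ¬ Rooted G (some y) := by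
  induction h with
  | rel u v h =>
    obtain ⟨e, he⟩ := h
    by_cases hu : Rooted G u
    · have hv : ¬ Rooted G v := by tauto
      cases v with
      | none => exact absurd (Or.inl rfl) hv
      | some y => exact ⟨e, u, y, Or.inl he, hu, hv⟩
    · have hv : Rooted G v := by by_contra hv; exact hne (iff_of_false hu hv)
      cases u with
      | none => exact absurd (Or.inl rfl) hu
      | some y => exact ⟨e, v, y, Or.inr he, hv, hu⟩
  | refl => exact absurd Iff.rfl hne
  | symm _ _ _ ih => exact ih (by tauto)
  | trans _ _ _ _ _ h1 h2 =>
    by_contra hc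
    exact hne ((not_not.1 (fun h => hc (h1 h))).trans (not_not.1 (fun h => hc (h2 h))))

theorem root_phase [Finite A] : ∀ (N : ℕ) (G : Gr A W) (_ : FinS G) (_ : ∀ v, Con G none v)
    (_ : ∀ a, ∃ e u v, G e = (u, [(a, true)], v))
    (_ : {w | ¬ Rooted G (some w)}.ncard = N), Triv (rel G) := by
  intro N
  induction N using Nat.strong_induction_on with
  | _ N ih =>
  intro G hf hc hl hN
  have hfin : {w | ¬ Rooted G (some w)}.Finite := by
    refine hf.subset ?_
    intro w hw h
    exact hw (Or.inr ⟨w, rfl, _, h⟩)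
  by_cases hall : ∀ w, Rooted G (some w)
  · refine final G hf ?_ hl
    intro w
    obtain h | ⟨w', h, e, he⟩ := hall w
    · cases h
    · cases h; exact ⟨e, he⟩
  push Not at hall
  obtain ⟨w, hw⟩ := hall
  obtain ⟨e, z, y, he, hz, hy⟩ := root_step (hc (some w))
    (fun h => hw (h.1 (Or.inl rfl)))
  have hzy : z ≠ some y := by rintro rfl; exact hy hz
  let G' := Function.update G e (some y, [], none)
  -- old rooting edges are different from e
  have hroot : ∀ x e', G e' = (some x, [], none) → e' ≠ e := by
    rintro x e' hx rfl
    rcases he with he | he <;> rw [he] at hx <;> simp at hx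
    obtain ⟨h1, h2⟩ := hx
    subst h1
    rw [h2] at he
    exact hy (Or.inr ⟨_, rfl, _, he⟩)
  have hroot' : ∀ x, Rooted G x → Rooted G' x := by
    rintro x (h | ⟨x', h, e', he'⟩)
    · exact Or.inl h
    · exact Or.inr ⟨x', h, e', by simp [G', Function.update_of_ne (hroot _ _ he'), he']⟩
  have hyr : Rooted G' (some y) := Or.inr ⟨y, rfl, e, by simp [G']⟩
  have hrc : ∀ x, Rooted G' x → Con G' x none := by
    rintro x (h | ⟨x', h, e', he'⟩)
    · rw [h]; exact Relation.EqvGen.refl _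
    · rw [h]; exact Relation.EqvGen.rel _ _ ⟨e', he'⟩
  have hpz : pr (rel G) {e} (tv z) = 1 := by
    obtain h | ⟨x', h, e', he'⟩ := hz
    · rw [h]; simp
    · have := pr_eq_one (rel G) {e} (j := e') (hroot _ _ he')
      rw [rel_of he'] at this
      rw [h]
      simpa using this
  have hE : Eqv (rel G) (rel G') := by
    rw [rel_update]
    rcases he with he | he
    · refine Eqv.changeInv _ _ _ ?_
      rw [rel_of he]; simp [edr, hpz]
    · refine Eqv.change _ _ _ ?_
      rw [rel_of he]; simp [edr, hpz]
  refine hE.trans (ih _ ?_ G' (hf.update _ _) ?_ ?_ rfl)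
  · rw [← hN]
    refine Set.ncard_lt_ncard ?_ hfin
    refine ⟨fun x hx h => hx (hroot' _ h), fun h => h (show y ∈ _ from hy) hyr⟩
  · intro v
    refine (hc v).mono ?_
    intro e' p q hpq
    by_cases hee : e' = e
    · subst hee
      have h1 := hrc _ hyr
      have h2 := hrc _ (hroot' _ hz)
      rcases he with he | he <;> rw [he] at hpq <;> simp at hpq <;> obtain ⟨rfl, rfl⟩ := hpq
      · exact h2.trans _ _ _ h1.symm
      · exact h1.trans _ _ _ h2.symm
    · exact Relation.EqvGen.rel _ _ ⟨e', by simp [G', hee, hpq]⟩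
  · intro a
    obtain ⟨e', p, q, h⟩ := hl a
    have : e' ≠ e := by
      rintro rfl
      rcases he with he | he <;> rw [he] at h <;> simp at h
    exact ⟨e', p, q, by simp [G', this, h]⟩


inductive Reach (G : Gr A W) : Option W → FreeGroup A → Option W → Prop
  | refl (v) : Reach G v 1 v
  | fwd (e u L v g z) (h : G e = (u, L, v)) (h' : Reach G v g z) : Reach G u (FreeGroup.mk L * g) z
  | bwd (e u L v g z) (h : G e = (u, L, v)) (h' : Reach G u g z) : Reach G v ((FreeGroup.mk L)⁻¹ * g) z

theorem Reach.trans {G : Gr A W} {u v z g h} (h1 : Reach G u g v) (h2 : Reach G v h z) :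
    Reach G u (g * h) z := by
  induction h1 with
  | refl => simpa using h2
  | fwd e u L v g z he _ ih => rw [mul_assoc]; exact Reach.fwd e _ _ _ _ _ he (ih h2)
  | bwd e u L v g z he _ ih => rw [mul_assoc]; exact Reach.bwd e _ _ _ _ _ he (ih h2)

theorem Reach.edge {G : Gr A W} {e u L v} (h : G e = (u, L, v)) : Reach G u (FreeGroup.mk L) v := by
  simpa using Reach.fwd e _ _ _ _ _ h (Reach.refl v)

theorem Reach.edge' {G : Gr A W} {e u L v} (h : G e = (u, L, v)) :
    Reach G v (FreeGroup.mk L)⁻¹ u := by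
  simpa using Reach.bwd e _ _ _ _ _ h (Reach.refl u)

theorem Reach.symm {G : Gr A W} {u v g} (h : Reach G u g v) : Reach G v g⁻¹ u := by
  induction h with
  | refl => simpa using Reach.refl _
  | fwd e u L v g z he _ ih => rw [mul_inv_rev]; exact ih.trans (Reach.edge' he)
  | bwd e u L v g z he _ ih => rw [mul_inv_rev, inv_inv]; exact ih.trans (Reach.edge he)

theorem Reach.map {G G' : Gr A W} (ρ : Option W → Option W)
    (hρ : ∀ e u L v, G e = (u, L, v) → Reach G' (ρ u) (FreeGroup.mk L) (ρ v))
    {u v g} (h : Reach G u g v) : Reach G' (ρ u) g (ρ v) := by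
  induction h with
  | refl => exact Reach.refl _
  | fwd e u L v g z he _ ih => exact (hρ _ _ _ _ he).trans ih
  | bwd e u L v g z he _ ih => exact (hρ _ _ _ _ he).symm.trans ih

theorem Con.reach {G : Gr A W} {u v} (h : Con G u v) : Reach G u 1 v := by
  induction h with
  | rel u v h => obtain ⟨e, he⟩ := h; exact Reach.edge he
  | refl => exact Reach.refl _
  | symm _ _ _ ih => simpa using ih.symm
  | trans _ _ _ _ _ h1 h2 => simpa using h1.trans h2

def Full (G : Gr A W) : Prop := ∀ g v, Reach G none g v

def Simple (E : Option W × List (A × Bool) × Option W) : Prop :=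
  E.2.1 = [] ∨ ∃ a, E.2.1 = [(a, true)]

def Imm (G : Gr A W) : Prop := ∀ e e' a u v u' v', G e = (u, [(a, true)], v) →
  G e' = (u', [(a, true)], v') → (Con G u u' ∨ Con G v v') → e = e'

/-- a traversal of an edge labelled by the given letter -/
def Tr (G : Gr A W) (x : A × Bool) (u v : Option W) : Prop :=
  ∃ e, G e = (if x.2 then (u, [(x.1, true)], v) else (v, [(x.1, true)], u))

def WP (G : Gr A W) : Option W → List (A × Bool) → Option W → Prop
  | u, [], v => Con G u v
  | u, x :: L, v => ∃ p q, Con G u p ∧ Tr G x p q ∧ WP G q L v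

theorem WP.con {G : Gr A W} {u u' L v} (h : Con G u' u) (hw : WP G u L v) : WP G u' L v := by
  cases L with
  | nil => exact h.trans _ _ _ hw
  | cons x L => obtain ⟨p, q, h1, h2, h3⟩ := hw; exact ⟨p, q, h.trans _ _ _ h1, h2, h3⟩

theorem Imm.tr {G : Gr A W} (hI : Imm G) {a b p q p' q'} (h1 : Tr G (a, b) p q)
    (h2 : Tr G (a, b) p' q') (h : Con G p p') : q = q' := by
  obtain ⟨e, he⟩ := h1
  obtain ⟨e', he'⟩ := h2
  cases b
  · simp at he he'
    have := hI _ _ _ _ _ _ _ he he' (Or.inr h)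
    subst this
    rw [he] at he'; simp at he'; exact he'.1
  · simp at he he'
    have := hI _ _ _ _ _ _ _ he he' (Or.inl h)
    subst this
    rw [he] at he'; simp at he'; exact he'.2

theorem Tr.symm {G : Gr A W} {a b p q} (h : Tr G (a, b) p q) : Tr G (a, !b) q p := by
  obtain ⟨e, he⟩ := h
  refine ⟨e, ?_⟩
  cases b <;> simpa using he

theorem Imm.step {G : Gr A W} (hI : Imm G) {L L' : List (A × Bool)} (hs : FreeGroup.Red.Step L L') :
    ∀ {u v}, WP G u L v → WP G u L' v := by
  cases hs with
  | @not L1 L2 a b =>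
    induction L1 with
    | nil =>
      intro u v h
      obtain ⟨p, q, h1, h2, p', q', h3, h4, h5⟩ := h
      have := hI.tr h2.symm h4 h3
      subst this
      exact h5.con h1
    | cons x L1 ih =>
      intro u v h
      obtain ⟨p, q, h1, h2, h3⟩ := h
      exact ⟨p, q, h1, h2, ih h3⟩

theorem Imm.red {G : Gr A W} (hI : Imm G) {L L' : List (A × Bool)} (hs : FreeGroup.Red L L')
    {u v} (h : WP G u L v) : WP G u L' v := by
  induction hs with
  | refl => exact h
  | tail _ hs ih => exact hI.step hs ih

theorem Reach.wp {G : Gr A W} (hS : ∀ e, Simple (G e)) {u g v} (h : Reach G u g v) :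
    ∃ L, FreeGroup.mk L = g ∧ WP G u L v := by
  induction h with
  | refl v => exact ⟨[], rfl, Relation.EqvGen.refl _⟩
  | fwd e u L v g z he _ ih =>
    obtain ⟨M, hM, hW⟩ := ih
    have := hS e
    rw [he] at this
    rcases this with h | ⟨a, h⟩ <;> simp only at h <;> subst h
    · exact ⟨M, by rw [← FreeGroup.one_eq_mk, one_mul, hM], hW.con (Relation.EqvGen.rel _ _ ⟨e, he⟩)⟩
    · refine ⟨(a, true) :: M, by rw [← hM]; simp, u, v, Relation.EqvGen.refl _, ⟨e, by simpa using he⟩, hW⟩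
  | bwd e u L v g z he _ ih =>
    obtain ⟨M, hM, hW⟩ := ih
    have := hS e
    rw [he] at this
    rcases this with h | ⟨a, h⟩ <;> simp only at h <;> subst h
    · exact ⟨M, by rw [← FreeGroup.one_eq_mk, inv_one, one_mul, hM], hW.con (Relation.EqvGen.rel _ _ ⟨e, he⟩).symm⟩
    · refine ⟨(a, false) :: M, by rw [← hM]; simp [FreeGroup.invRev], v, u, Relation.EqvGen.refl _, ⟨e, by simpa using he⟩, hW⟩

theorem Imm.loop {G : Gr A W} (hI : Imm G) (hS : ∀ e, Simple (G e)) (hF : Full G) (a : A) (b : Bool) :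
    ∃ p q, Con G none p ∧ Tr G (a, b) p q ∧ Con G q none := by
  obtain ⟨L, hL, hW⟩ := (hF (FreeGroup.mk [(a, b)]) none).wp hS
  have hr : FreeGroup.Red L [(a, b)] := by
    have h1 := FreeGroup.reduce.red (L := L)
    have h2 : FreeGroup.reduce L = [(a, b)] := by
      have := congrArg FreeGroup.toWord hL
      simpa [FreeGroup.toWord_mk] using this
    rwa [h2] at h1
  exact hI.red hr hW

theorem Imm.all {G : Gr A W} (hI : Imm G) (hS : ∀ e, Simple (G e)) (hF : Full G) (v) : Con G none v := by
  obtain ⟨L, -, hW⟩ := (hF 1 v).wp hS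
  have : ∀ (L : List (A × Bool)) u, Con G none u → WP G u L v → Con G none v := by
    intro L
    induction L with
    | nil => intro u h1 h2; exact h1.trans _ _ _ h2
    | cons x L ih =>
      rintro u h1 ⟨p, q, h2, h3, h4⟩
      obtain ⟨p', q', h5, h6, h7⟩ := hI.loop hS hF x.1 x.2
      have := hI.tr h3 h6 ((h1.trans _ _ _ h2).symm.trans _ _ _ h5)
      subst this
      exact ih q h7.symm h4
  exact this L none (Relation.EqvGen.refl _) hW

theorem fold_phase [Finite A] : ∀ (N : ℕ) (G : Gr A W) (_ : FinS G) (_ : ∀ e, Simple (G e)) (_ : Full G)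
    (_ : {e | (G e).2.1 ≠ []}.ncard = N), Triv (rel G) := by
  intro N
  induction N using Nat.strong_induction_on with
  | _ N ih =>
  intro G hf hS hF hN
  have hfin : {e | (G e).2.1 ≠ []}.Finite := by
    refine ((Set.finite_range (Sum.inl : A → A ⊕ W)).union (hf.image Sum.inr)).subset ?_
    rintro (a | w) hx
    · left; simp
    · right
      refine ⟨w, fun h => hx (by rw [h]), rfl⟩
  by_cases hI : Imm G
  · refine root_phase _ G hf (hI.all hS hF) ?_ rfl
    intro a
    obtain ⟨p, q, _, ⟨e, he⟩, _⟩ := hI.loop hS hF a true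
    exact ⟨e, p, q, by simpa using he⟩
  unfold Imm at hI
  push Not at hI
  obtain ⟨e, e', a, u, v, u', v', he, he', hcon, hne⟩ := hI
  have hout : ∀ x ∈ ({e'} : Set (A ⊕ W)), ∀ u v, G x ≠ (u, [], v) := by
    rintro x rfl p q h
    rw [he'] at h; simp at h
  have hpe := pr_eq_one (rel G) {e'} (j := e) hne
  rw [rel_of he] at hpe
  have hcon' : ∀ E u v, Con G u v → Con (Function.update G e' E) u v := by
    intro E u v h
    refine h.mono ?_
    intro x p q hx
    have : x ≠ e' := fun h => hout x h _ _ hx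
    exact Relation.EqvGen.rel _ _ ⟨x, by simp [this, hx]⟩
  have go : ∀ p q, pr (rel G) {e'} (rel G e') = pr (rel G) {e'} (edr (p, [], q)) →
      Reach (Function.update G e' (p, [], q)) u' (FreeGroup.mk [(a, true)]) v' → Triv (rel G) := by
    intro p q h1 h2
    have hE := Eqv.change _ _ _ h1
    rw [← rel_update] at hE
    refine hE.trans (ih _ ?_ _ (hf.update _ _) ?_ ?_ rfl)
    · rw [← hN]
      refine Set.ncard_lt_ncard ?_ hfin
      refine ⟨fun x hx => ?_, fun h => ?_⟩
      · by_cases hxe : x = e'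
        · subst hxe; simp at hx
        · simpa [hxe] using hx
      · have := h (show e' ∈ _ by simp [he'])
        simp at this
    · intro x
      by_cases hxe : x = e'
      · subst hxe; simp [Simple]
      · simpa [hxe] using hS x
    · intro g z
      refine Reach.map (G := G) id ?_ (hF g z)
      intro x p' L q' hx
      by_cases hxe : x = e'
      · subst hxe
        rw [he'] at hx; simp at hx; obtain ⟨rfl, rfl, rfl⟩ := hx
        exact h2
      · exact Reach.edge (e := x) (by simp [hxe, hx])
  rcases hcon with hc | hc
  · refine go v v' ?_ ?_
    · have := hc.pr_eq hout
      rw [rel_of he']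
      simp only [edr, map_mul, map_inv, xw_nil, map_one, mul_one] at hpe ⊢
      rw [← this, mul_inv_eq_one.1 hpe]
    · have h1 := (hcon' (v, [], v') _ _ hc).reach.symm
      have h2 := Reach.edge (G := Function.update G e' (v, [], v')) (e := e) (u := u) (v := v)
        (L := [(a, true)]) (by simp [hne, he])
      have h3 := Reach.edge (G := Function.update G e' (v, [], v')) (e := e') (u := v) (v := v')
        (L := []) (by simp)
      have := (h1.trans h2).trans h3
      simpa [← FreeGroup.one_eq_mk] using this
  · refine go u' u ?_ ?_
    · have := hc.pr_eq hout
      rw [rel_of he']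
      simp only [edr, map_mul, map_inv, xw_nil, map_one, mul_one] at hpe ⊢
      rw [← this, ← mul_inv_eq_one.1 hpe]; group
    · have h1 := (hcon' (u', [], u) _ _ hc).reach
      have h2 := Reach.edge (G := Function.update G e' (u', [], u)) (e := e) (u := u) (v := v)
        (L := [(a, true)]) (by simp [hne, he])
      have h3 := Reach.edge (G := Function.update G e' (u', [], u)) (e := e') (u := u') (v := u)
        (L := []) (by simp)
      have := (h3.trans h2).trans h1
      simpa [← FreeGroup.one_eq_mk] using this

theorem exists_fresh [Finite A] [Infinite W] (G : Gr A W) (hf : FinS G) :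
    ∃ w : W, G (Sum.inr w) = (some w, [], none) ∧
      ∀ e, e ≠ Sum.inr w → (G e).1 ≠ some w ∧ (G e).2.2 ≠ some w := by
  let D : Set (A ⊕ W) := Set.range Sum.inl ∪ Sum.inr '' {w | G (Sum.inr w) ≠ (some w, [], none)}
  have hD : D.Finite := (Set.finite_range _).union (hf.image _)
  have hB : ({w | G (Sum.inr w) ≠ (some w, [], none)} ∪
      (some ⁻¹' ((fun e => (G e).1) '' D) ∪ some ⁻¹' ((fun e => (G e).2.2) '' D)) : Set W).Finite :=
    hf.union (((hD.image _).preimage (Option.some_injective _).injOn).union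
      ((hD.image _).preimage (Option.some_injective _).injOn))
  obtain ⟨w, hw⟩ := hB.exists_notMem
  have h1 : G (Sum.inr w) = (some w, [], none) := by
    by_contra h; exact hw (Or.inl h)
  refine ⟨w, h1, ?_⟩
  intro e he
  by_cases heD : e ∈ D
  · exact ⟨fun h => hw (Or.inr (Or.inl ⟨e, heD, h⟩)), fun h => hw (Or.inr (Or.inr ⟨e, heD, h⟩))⟩
  · rcases e with a | w'
    · exact absurd (Or.inl ⟨a, rfl⟩) heD
    · have : G (Sum.inr w') = (some w', [], none) := by
        by_contra h; exact heD (Or.inr ⟨w', h, rfl⟩)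
      rw [this]
      refine ⟨fun h => he ?_, by simp⟩
      simp at h; rw [h]

theorem hom_xw {H : Type} [Group H] (φ ψ : FreeGroup (A ⊕ W) →* H)
    (h : ∀ a, φ (FreeGroup.of (Sum.inl a)) = ψ (FreeGroup.of (Sum.inl a))) (L : List (A × Bool)) :
    φ (xw L) = ψ (xw L) := by
  have : φ.comp (FreeGroup.map Sum.inl) = ψ.comp (FreeGroup.map Sum.inl) := by
    ext a; simpa using h a
  exact DFunLike.congr_fun this (FreeGroup.mk L)

theorem cut_triv (G : Gr A W) (e : A ⊕ W) (w : W) (u v : Option W) (a : A) (b : Bool)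
    (L : List (A × Bool)) (he : G e = (u, (a, b) :: L, v))
    (hw : G (Sum.inr w) = (some w, [], none))
    (hfr : ∀ e, e ≠ Sum.inr w → (G e).1 ≠ some w ∧ (G e).2.2 ≠ some w)
    (h : Triv (rel (Function.update (Function.update G e (some w, L, v)) (Sum.inr w)
      (if b then (u, [(a, true)], some w) else (some w, [(a, true)], u))))) : Triv (rel G) := by
  have hew : e ≠ Sum.inr w := by rintro rfl; rw [hw] at he; simp at he
  have hu : u ≠ some w := by have := (hfr e hew).1; rwa [he] at this
  have hv : v ≠ some w := by have := (hfr e hew).2; rwa [he] at this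
  let c : FreeGroup (A ⊕ W) := tv u * xw [(a, b)]
  let φ : FreeGroup (A ⊕ W) →* FreeGroup (A ⊕ W) :=
    FreeGroup.lift (Function.update FreeGroup.of (Sum.inr w) (FreeGroup.of (Sum.inr w) * c))
  have hφw : φ (FreeGroup.of (Sum.inr w)) = FreeGroup.of (Sum.inr w) * c := by simp [φ]
  have hφ : ∀ i, i ≠ Sum.inr w → φ (FreeGroup.of i) = FreeGroup.of i := by
    intro i hi; simp [φ, hi]
  have hφx : ∀ M, φ (xw M) = xw M := by
    intro M
    exact hom_xw φ (MonoidHom.id _) (fun a => hφ _ (by simp)) M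
  have hφt : ∀ z, z ≠ some w → φ (tv z) = tv z := by
    rintro (_ | z) hz
    · simp
    · exact hφ _ (by simpa using hz)
  have hφT : Triv (fun i => φ (FreeGroup.of i)) := by
    refine Eqv.symm ?_
    have e1 : (fun i => φ (FreeGroup.of i)) =
        Function.update FreeGroup.of (Sum.inr w) (FreeGroup.of (Sum.inr w) * c) := by
      funext i; simp [φ]
    rw [e1]
    refine Eqv.change _ _ _ ?_
    have h1 : ∀ i : A ⊕ W, i ≠ Sum.inr w → pr FreeGroup.of {Sum.inr w} (FreeGroup.of i) = 1 :=
      fun i hi => pr_eq_one FreeGroup.of _ hi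
    have h2 : pr FreeGroup.of {(Sum.inr w : A ⊕ W)} (xw [(a, b)]) = 1 :=
      hom_xw _ 1 (fun a => h1 _ (by simp)) _
    have h3 : pr FreeGroup.of {(Sum.inr w : A ⊕ W)} (tv u) = 1 := by
      rcases u with _ | z
      · simp
      · exact h1 _ (by simpa using hu)
    simp [c, h2, h3]
  have hT := h.hom φ hφT
  refine Eqv.trans ?_ hT
  have s1 : Eqv (rel G) (Function.update (rel G) e (FreeGroup.of (Sum.inr w) * rel G e)) := by
    refine Eqv.change _ _ _ ?_
    have := pr_eq_one (rel G) {e} (j := Sum.inr w) hew.symm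
    rw [rel_of hw] at this
    simp at this
    simp [this]
  have hrw : rel G (Sum.inr w) = FreeGroup.of (Sum.inr w) := by rw [rel_of hw]; simp
  have hcc : tv u * xw ((a, b) :: L) = c * xw L := by
    have : (FreeGroup.mk ((a, b) :: L)) = FreeGroup.mk [(a, b)] * FreeGroup.mk L := by simp
    simp only [c, xw, this, map_mul, mul_assoc]
  have hfe : φ (edr (some w, L, v)) = FreeGroup.of (Sum.inr w) * rel G e := by
    rw [rel_of he, hcc]
    simp only [edr, map_mul, map_inv, tv_some, hφw, hφx, hφt v hv, mul_assoc]
  have hoth : ∀ i, i ≠ Sum.inr w → φ (rel G i) = rel G i := by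
    intro i hi
    simp only [rel, edr, map_mul, map_inv, hφx, hφt _ (hfr i hi).1, hφt _ (hfr i hi).2]
  have e2 : ∀ E, (fun i => φ (rel (Function.update (Function.update G e (some w, L, v)) (Sum.inr w) E) i))
      = Function.update (Function.update (rel G) e (FreeGroup.of (Sum.inr w) * rel G e)) (Sum.inr w)
        (φ (edr E)) := by
    intro E
    funext i
    rw [rel_update, rel_update]
    by_cases hi : i = Sum.inr w
    · subst hi; simp
    · by_cases hie : i = e
      · subst hie; simp [hi, hfe]
      · simp [hi, hie, hoth i hi]
  rw [e2]
  refine s1.trans ?_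
  cases b
  · refine Eqv.change _ _ _ (congrArg _ ?_)
    rw [Function.update_of_ne hew.symm, hrw]
    have hx : (xw [(a, true)] : FreeGroup (A ⊕ W)) = (xw [(a, false)])⁻¹ := by
      rw [xw, xw, ← map_inv]; simp [FreeGroup.invRev]
    simp [edr, hφw, hφx, hφt u hu, c, hx, mul_assoc]
  · refine Eqv.changeInv _ _ _ ?_
    rw [← map_inv]
    refine congrArg _ ?_
    rw [Function.update_of_ne hew.symm, hrw]
    simp [edr, hφw, hφx, hφt u hu, c, mul_assoc]

theorem cut_full (G : Gr A W) (e : A ⊕ W) (w : W) (u v : Option W) (a : A) (b : Bool)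
    (L : List (A × Bool)) (he : G e = (u, (a, b) :: L, v))
    (hw : G (Sum.inr w) = (some w, [], none))
    (hfr : ∀ e, e ≠ Sum.inr w → (G e).1 ≠ some w ∧ (G e).2.2 ≠ some w) (hF : Full G) :
    Full (Function.update (Function.update G e (some w, L, v)) (Sum.inr w)
      (if b then (u, [(a, true)], some w) else (some w, [(a, true)], u))) := by
  have hew : e ≠ Sum.inr w := by rintro rfl; rw [hw] at he; simp at he
  have hu : u ≠ some w := by have := (hfr e hew).1; rwa [he] at this
  have hv : v ≠ some w := by have := (hfr e hew).2; rwa [he] at this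
  generalize hG' : Function.update (Function.update G e (some w, L, v)) (Sum.inr w)
      (if b then (u, [(a, true)], some w) else (some w, [(a, true)], u)) = G'
  have hs1 : Reach G' u (FreeGroup.mk [(a, b)]) (some w) := by
    cases b
    · have := Reach.edge' (G := G') (e := Sum.inr w) (u := some w) (L := [(a, true)]) (v := u)
        (by simp [← hG'])
      simpa [FreeGroup.invRev] using this
    · exact Reach.edge (e := Sum.inr w) (by simp [← hG'])
  have hs2 : Reach G' (some w) (FreeGroup.mk L) v :=
    Reach.edge (e := e) (by simp [← hG', hew])
  let ρ : Option W → Option W := fun z => if z = some w then none else z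
  have hρ : ∀ g z, Reach G' none g (ρ z) := by
    intro g z
    refine Reach.map (G := G) ρ ?_ (hF g z)
    intro x p M q hx
    by_cases hxw : x = Sum.inr w
    · subst hxw
      rw [hw] at hx; simp at hx; obtain ⟨rfl, rfl, rfl⟩ := hx
      simpa [ρ, ← FreeGroup.one_eq_mk] using Reach.refl (G := G') none
    · have h12 := hfr x hxw
      rw [hx] at h12
      have hp : ρ p = p := by simp only [ρ]; rw [if_neg h12.1]
      have hq : ρ q = q := by simp only [ρ]; rw [if_neg h12.2]
      rw [hp, hq]
      by_cases hxe : x = e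
      · subst hxe
        rw [he] at hx; simp at hx; obtain ⟨rfl, rfl, rfl⟩ := hx
        simpa using hs1.trans hs2
      · exact Reach.edge (e := x) (by simp [← hG', hxw, hxe, hx])
  intro g z
  by_cases hz : z = some w
  · subst hz
    have := hρ (g * (FreeGroup.mk [(a, b)])⁻¹) u
    have hp : ρ u = u := by simp only [ρ]; rw [if_neg hu]
    rw [hp] at this
    have := this.trans hs1
    rwa [inv_mul_cancel_right] at this
  · have := hρ g z
    have hp : ρ z = z := by simp only [ρ]; rw [if_neg hz]
    rwa [hp] at this

open Classical in
noncomputable def bad (E : Option W × List (A × Bool) × Option W) : ℕ :=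
  if Simple E then 0 else E.2.1.length

theorem cut_phase [Finite A] [Infinite W] (S : Finset (A ⊕ W)) : ∀ (N : ℕ) (G : Gr A W) (_ : FinS G)
    (_ : Full G) (_ : ∀ e ∉ S, Simple (G e)) (_ : ∑ e ∈ S, bad (G e) = N), Triv (rel G) := by
  intro N
  induction N using Nat.strong_induction_on with
  | _ N ih =>
  intro G hf hF hS hN
  by_cases hall : ∀ e, Simple (G e)
  · exact fold_phase _ G hf hall hF rfl
  push Not at hall
  obtain ⟨e, hes⟩ := hall
  have heS : e ∈ S := by by_contra h; exact hes (hS e h)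
  obtain ⟨w, hw, hfr⟩ := exists_fresh G hf
  obtain ⟨u, M, v, he⟩ : ∃ u M v, G e = (u, M, v) := ⟨_, _, _, rfl⟩
  rcases M with _ | ⟨⟨a, b⟩, L⟩
  · exact absurd (Or.inl (by rw [he])) hes
  have hew : e ≠ Sum.inr w := by rintro rfl; rw [hw] at he; simp at he
  have hsim : Simple (if b then (u, [(a, true)], some w) else (some w, [(a, true)], u)) := by
    right; refine ⟨a, ?_⟩; cases b <;> simp
  refine cut_triv G e w u v a b L he hw hfr ?_
  refine ih _ ?_ _ ((hf.update _ _).update _ _) (cut_full G e w u v a b L he hw hfr hF) ?_ rfl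
  · rw [← hN]
    refine Finset.sum_lt_sum ?_ ⟨e, heS, ?_⟩
    · intro i _
      by_cases hi : i = Sum.inr w
      · subst hi; simp only [Function.update_self]; simp [bad, hsim]
      · by_cases hie : i = e
        · subst hie
          simp only [Function.update_of_ne hi, Function.update_self]
          simp only [bad, hes, if_false, he]
          split_ifs <;> simp
        · simp [hi, hie]
    · simp only [Function.update_of_ne hew, Function.update_self]
      simp only [bad, hes, if_false, he]
      split_ifs <;> simp
  · intro x hx
    by_cases hi : x = Sum.inr w
    · subst hi; simp only [Function.update_self]; exact hsim
    · have hie : x ≠ e := by rintro rfl; exact hx heS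
      simpa [hi, hie] using hS x hx

theorem surj_triv [Finite A] [Infinite W] (ψ : FreeGroup A →* FreeGroup A) (hψ : Function.Surjective ψ) :
    Triv (Sum.elim (fun a => FreeGroup.map Sum.inl (ψ (FreeGroup.of a)))
      (fun w => FreeGroup.of (Sum.inr w)) : A ⊕ W → FreeGroup (A ⊕ W)) := by
  have := Fintype.ofFinite A
  let G : Gr A W := Sum.elim (fun a => (none, (ψ (FreeGroup.of a)).toWord, none))
    (fun w => (some w, [], none))
  have hrel : rel G = Sum.elim (fun a => FreeGroup.map Sum.inl (ψ (FreeGroup.of a)))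
      (fun w => FreeGroup.of (Sum.inr w)) := by
    funext x
    rcases x with a | w
    · simp [rel, G, edr, xw, FreeGroup.mk_toWord]
    · simp [rel, G, edr]
  rw [← hrel]
  refine cut_phase (Finset.univ.image Sum.inl) _ G ?_ ?_ ?_ rfl
  · simp [FinS, G]
  · have hn : ∀ g, Reach G none (ψ g) none := by
      have h0 : ∀ a, Reach G none (ψ (FreeGroup.of a)) none := by
        intro a
        have := Reach.edge (G := G) (e := Sum.inl a) (u := none) (L := (ψ (FreeGroup.of a)).toWord) (v := none) rfl
        rwa [FreeGroup.mk_toWord] at this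
      intro g
      induction g using FreeGroup.induction_on with
      | C1 => simpa using Reach.refl (G := G) none
      | of a => exact h0 a
      | inv_of a h => rw [map_inv]; exact h.symm
      | mul x y hx hy => rw [map_mul]; exact hx.trans hy
    intro g v
    obtain ⟨g, rfl⟩ := hψ g
    rcases v with _ | w
    · exact hn g
    · have := (hn g).trans (Reach.edge' (G := G) (e := Sum.inr w) (u := some w) (L := []) (v := none) rfl)
      simpa [← FreeGroup.one_eq_mk] using this
  · rintro (a | w) h
    · simp at h
    · left; rfl

end Graph

section Hat

def hat {n : ℕ} (r : Fin n → FreeGroup (Fin n)) : ℕ → FreeGroup ℕ :=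
  fun k => if h : k < n then FreeGroup.map Fin.val (r ⟨k, h⟩) else FreeGroup.of k

theorem hat_fin {n : ℕ} (r : Fin n → FreeGroup (Fin n)) (i : Fin n) :
    hat r i = FreeGroup.map Fin.val (r i) := by simp [hat]

theorem hat_ge {n : ℕ} (r : Fin n → FreeGroup (Fin n)) {k : ℕ} (h : n ≤ k) :
    hat r k = FreeGroup.of k := by simp [hat, h]

theorem hat_of (n : ℕ) : hat (fun i : Fin n => FreeGroup.of i) = FreeGroup.of := by
  funext k; by_cases h : k < n <;> simp [hat, h]

theorem hat_update {n : ℕ} (r : Fin n → FreeGroup (Fin n)) (i : Fin n) (c) :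
    hat (Function.update r i c) = Function.update (hat r) i (FreeGroup.map Fin.val c) := by
  funext k
  by_cases hk : k < n
  · obtain ⟨k, rfl⟩ : ∃ k' : Fin n, (k' : ℕ) = k := ⟨⟨k, hk⟩, rfl⟩
    rw [hat_fin]
    by_cases hki : k = i
    · subst hki; simp
    · rw [Function.update_of_ne hki, Function.update_of_ne (fun h => hki (Fin.ext h)), hat_fin]
  · have : k ≠ i := by have := i.2; omega
    rw [Function.update_of_ne this, hat_ge _ (by omega), hat_ge _ (by omega)]

theorem hat_stab {n : ℕ} (r : Fin n → FreeGroup (Fin n)) :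
    hat (Fin.snoc (fun i => FreeGroup.map Fin.castSucc (r i)) (FreeGroup.of (Fin.last n)) :
      Fin (n + 1) → FreeGroup (Fin (n + 1))) = hat r := by
  funext k
  by_cases hk : k < n
  · have h1 := hat_fin (Fin.snoc (fun i => FreeGroup.map Fin.castSucc (r i)) (FreeGroup.of (Fin.last n)) :
      Fin (n + 1) → FreeGroup (Fin (n + 1))) (Fin.castSucc ⟨k, hk⟩)
    have h2 := hat_fin r ⟨k, hk⟩
    simp only [Fin.snoc_castSucc, Fin.val_castSucc] at h1 h2
    rw [h1, h2, FreeGroup.map.comp]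
    rfl
  · by_cases hk' : k = n
    · subst hk'
      have h1 := hat_fin (Fin.snoc (fun i => FreeGroup.map Fin.castSucc (r i)) (FreeGroup.of (Fin.last k)) :
        Fin (k + 1) → FreeGroup (Fin (k + 1))) (Fin.last k)
      simp only [Fin.snoc_last, Fin.val_last, FreeGroup.map.of] at h1
      rw [h1, hat_ge _ le_rfl]
    · rw [hat_ge _ (by omega), hat_ge _ (by omega)]

theorem hat_inj {n : ℕ} {r s : Fin n → FreeGroup (Fin n)} (h : hat r = hat s) : r = s := by
  funext i
  have := congrFun h i
  rw [hat_fin, hat_fin] at this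
  exact FreeGroup.map_injective Fin.val_injective this

theorem hat_auto {n : ℕ} (r : Fin n → FreeGroup (Fin n)) (ψ : FreeGroup (Fin n) →* FreeGroup (Fin n)) :
    hat (fun i => ψ (r i)) =
      fun k => FreeGroup.lift (hat (fun i => ψ (FreeGroup.of i))) (hat r k) := by
  funext k
  by_cases hk : k < n
  · obtain ⟨k, rfl⟩ : ∃ k' : Fin n, (k' : ℕ) = k := ⟨⟨k, hk⟩, rfl⟩
    rw [hat_fin, hat_fin]
    have : (FreeGroup.map Fin.val).comp ψ =
        (FreeGroup.lift (hat (fun i => ψ (FreeGroup.of i)))).comp (FreeGroup.map Fin.val) := by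
      ext a
      simp [hat_fin]
    exact DFunLike.congr_fun this (r k)
  · rw [hat_ge _ (by omega), hat_ge _ (by omega)]
    simp [hat_ge _ (not_lt.1 hk)]

theorem Eqv.reindex {ι κ α : Type} [DecidableEq ι] [DecidableEq κ] (f : κ ≃ ι)
    {r s : ι → FreeGroup α} (h : Eqv r s) : Eqv (r ∘ f) (s ∘ f) := by
  induction h with
  | refl => exact Eqv.refl _
  | tail _ h ih =>
    refine ih.trans ?_
    cases h with
    | inv i =>
      rw [Function.update_comp_equiv]
      simpa using Eqv.inv (_ ∘ f) (f.symm i)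
    | mul i j hij =>
      rw [Function.update_comp_equiv]
      simpa using Eqv.mul (_ ∘ f) (f.symm i) (f.symm j) (by simpa using hij)
    | conj i a =>
      rw [Function.update_comp_equiv]
      simpa using (Mv.conj (_ ∘ f) (f.symm i) a).eqv
    | conjInv i a =>
      rw [Function.update_comp_equiv]
      simpa using (Mv.conjInv (_ ∘ f) (f.symm i) a).eqv

theorem auto_triv {n : ℕ} (ψ : FreeGroup (Fin n) ≃* FreeGroup (Fin n)) :
    Triv (hat (fun i => ψ (FreeGroup.of i))) := by
  have h := surj_triv (W := ℕ) ψ.toMonoidHom ψ.surjective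
  have h2 := (Eqv.hom h (FreeGroup.map (finSumNatEquiv n))).reindex (finSumNatEquiv n).symm
  unfold Triv
  convert h2 using 1
  · funext k
    by_cases hk : k < n
    · simp [hat, hk, FreeGroup.map.comp]
      rfl
    · have hk := not_lt.1 hk
      simp [hat_ge _ hk, hk]
  · funext k
    simp

theorem triv_step {P Q : Σ n : ℕ, Fin n → FreeGroup (Fin n)} (h : QMove P Q) (hQ : Triv (hat Q.2)) :
    Triv (hat P.2) := by
  cases h with
  | inv n r i =>
    simp only [hat_update, map_inv] at hQ
    refine Eqv.trans ?_ hQ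
    rw [← hat_fin]; exact Eqv.inv _ _
  | mul n r i j hij =>
    simp only [hat_update, map_mul] at hQ
    refine Eqv.trans ?_ hQ
    rw [← hat_fin, ← hat_fin]; exact Eqv.mul _ _ _ (fun h => hij (Fin.ext h))
  | conj n r i j =>
    simp only [hat_update, map_mul, map_inv] at hQ
    refine Eqv.trans ?_ hQ
    rw [← hat_fin r i]; exact Eqv.conj _ _ _
  | conjInv n r i j =>
    simp only [hat_update, map_mul, map_inv] at hQ
    refine Eqv.trans ?_ hQ
    rw [← hat_fin r i]
    simpa using Eqv.conj (FreeGroup.map Fin.val (FreeGroup.of j))⁻¹ (hat r) i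
  | stab n r => simpa only [hat_stab] using hQ
  | destab n r => simpa only [hat_stab] using hQ
  | auto n r ψ =>
    have h1 := hQ.hom (FreeGroup.lift (hat (fun i => ψ.symm (FreeGroup.of i))))
      (by simpa using auto_triv ψ.symm)
    have h2 := hat_auto (fun i => ψ (r i)) ψ.symm.toMonoidHom
    simp only [MulEquiv.coe_toMonoidHom, MulEquiv.symm_apply_apply] at h2
    simp only at h1 ⊢
    rw [h2]
    exact h1

theorem ac_of_triv {s : ℕ → FreeGroup ℕ} (h : Eqv s FreeGroup.of) :
    ∃ N₀, ∀ N, N₀ ≤ N → ∀ P : Fin N → FreeGroup (Fin N), hat P = s →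
      ACEquiv ⟨N, P⟩ ⟨N, fun i => FreeGroup.of i⟩ := by
  induction h using ReflTransGen.head_induction_on with
  | refl =>
    refine ⟨0, fun N _ P hP => ?_⟩
    rw [← hat_of N] at hP
    rw [hat_inj hP]
    exact ReflTransGen.refl
  | head h _ ih =>
    obtain ⟨N₀, ih⟩ := ih
    cases h with
    | inv i =>
      refine ⟨N₀ + i + 1, fun N hN P hP => ?_⟩
      subst hP
      obtain ⟨i, rfl⟩ : ∃ i' : Fin N, (i' : ℕ) = i := ⟨⟨i, by omega⟩, rfl⟩
      refine ReflTransGen.head (ACMove.inv N P i) (ih N (by omega) _ ?_)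
      rw [hat_update, map_inv, hat_fin]
    | mul i j hij =>
      refine ⟨N₀ + i + j + 1, fun N hN P hP => ?_⟩
      subst hP
      obtain ⟨i, rfl⟩ : ∃ i' : Fin N, (i' : ℕ) = i := ⟨⟨i, by omega⟩, rfl⟩
      obtain ⟨j, rfl⟩ : ∃ i' : Fin N, (i' : ℕ) = j := ⟨⟨j, by omega⟩, rfl⟩
      refine ReflTransGen.head (ACMove.mul N P i j (fun h => hij (congrArg _ h))) (ih N (by omega) _ ?_)
      rw [hat_update, map_mul, hat_fin, hat_fin]
    | conj i j =>
      refine ⟨N₀ + i + j + 1, fun N hN P hP => ?_⟩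
      subst hP
      obtain ⟨i, rfl⟩ : ∃ i' : Fin N, (i' : ℕ) = i := ⟨⟨i, by omega⟩, rfl⟩
      obtain ⟨j, rfl⟩ : ∃ i' : Fin N, (i' : ℕ) = j := ⟨⟨j, by omega⟩, rfl⟩
      refine ReflTransGen.head (ACMove.conj N P i j) (ih N (by omega) _ ?_)
      rw [hat_update, map_mul, map_mul, map_inv, hat_fin, FreeGroup.map.of]
    | conjInv i j =>
      refine ⟨N₀ + i + j + 1, fun N hN P hP => ?_⟩
      subst hP
      obtain ⟨i, rfl⟩ : ∃ i' : Fin N, (i' : ℕ) = i := ⟨⟨i, by omega⟩, rfl⟩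
      obtain ⟨j, rfl⟩ : ∃ i' : Fin N, (i' : ℕ) = j := ⟨⟨j, by omega⟩, rfl⟩
      refine ReflTransGen.head (ACMove.conjInv N P i j) (ih N (by omega) _ ?_)
      rw [hat_update, map_mul, map_mul, map_inv, hat_fin, FreeGroup.map.of]

theorem stab_many {n : ℕ} (r : Fin n → FreeGroup (Fin n)) (k : ℕ) :
    ∃ P : Fin (n + k) → FreeGroup (Fin (n + k)), hat P = hat r ∧
      ACEquiv ⟨n, r⟩ ⟨n + k, P⟩ ∧ ACEquiv ⟨n + k, P⟩ ⟨n, r⟩ := by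
  induction k with
  | zero => exact ⟨r, rfl, ReflTransGen.refl, ReflTransGen.refl⟩
  | succ k ih =>
    obtain ⟨P, h1, h2, h3⟩ := ih
    exact ⟨_, (hat_stab P).trans h1, ReflTransGen.tail h2 (ACMove.stab _ P),
      ReflTransGen.head (ACMove.destab _ P) h3⟩

end Hat
end QAC

/-- If a balanced presentation can be converted to the trivial presentation by a finite
sequence of moves (1)-(5) (i.e. it is Q**-equivalent to the trivial presentation), then
it is AC-trivial. -/
theorem acTrivial_of_qTrivial (n : ℕ) (r : Fin n → FreeGroup (Fin n))
    (h : Relation.ReflTransGen QMove ⟨n, r⟩ ⟨n, fun i => FreeGroup.of i⟩) :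
    ACTrivial r := by
  have key : QAC.Triv (QAC.hat r) := by
    have : ∀ P : Σ n : ℕ, Fin n → FreeGroup (Fin n),
        Relation.ReflTransGen QMove P ⟨n, fun i => FreeGroup.of i⟩ → QAC.Triv (QAC.hat P.2) := by
      intro P hP
      induction hP using Relation.ReflTransGen.head_induction_on with
      | refl => simp only [QAC.hat_of]; exact QAC.Eqv.refl _
      | head h _ ih => exact QAC.triv_step h ih
    exact this _ h
  obtain ⟨N₀, hN⟩ := QAC.ac_of_triv key
  obtain ⟨P, h1, h2, -⟩ := QAC.stab_many r N₀
  obtain ⟨T, h4, -, h5⟩ := QAC.stab_many (fun i : Fin n => FreeGroup.of i) N₀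
  have hT : T = fun i => FreeGroup.of i := by
    apply QAC.hat_inj; rw [h4, QAC.hat_of, QAC.hat_of]
  subst hT
  exact (Relation.ReflTransGen.trans h2 (hN _ (by omega) P h1)).trans h5
end

section
/- If a balanced presentation P = (r_1, …, r_n) with n generators can be converted to the trivial presentation by a finite sequence of moves of types (1)–(5), then there exists m ≥ n such that the stabilized presentation (r_1, …, r_n, x_{n+1}, …, x_m) with m generators can be converted to the trivial presentation (x_1, …, x_m) by a finite sequence of moves of types (1), (2), (3), and (5) only. -/
/-- The stabilization of a presentation to `m` generators. -/
def stabTo {k m : ℕ} (h : k ≤ m) (r : Fin k → FreeGroup (Fin k)) (i : Fin m) :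
    FreeGroup (Fin m) :=
  if hi : (i : ℕ) < k then FreeGroup.map (Fin.castLE h) (r ⟨i, hi⟩) else FreeGroup.of i

theorem stabTo_update {k m : ℕ} (h : k ≤ m) (r : Fin k → FreeGroup (Fin k)) (i : Fin k)
    (w : FreeGroup (Fin k)) :
    stabTo h (Function.update r i w) =
      Function.update (stabTo h r) (Fin.castLE h i) (FreeGroup.map (Fin.castLE h) w) := by
  funext j
  by_cases hj : (j : ℕ) < k
  · by_cases e : j = Fin.castLE h i
    · subst e
      simp [stabTo]
    · have e' : (⟨j, hj⟩ : Fin k) ≠ i := by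
        rintro rfl
        exact e rfl
      simp [stabTo, hj, Function.update_of_ne e, Function.update_of_ne e']
  · have e : j ≠ Fin.castLE h i := by
      rintro rfl
      exact hj i.2
    simp [stabTo, hj, Function.update_of_ne e]

theorem stabTo_castLE {k m : ℕ} (h : k ≤ m) (r : Fin k → FreeGroup (Fin k)) (i : Fin k) :
    stabTo h r (Fin.castLE h i) = FreeGroup.map (Fin.castLE h) (r i) := by
  simp [stabTo]

theorem stabTo_of {k m : ℕ} (h : k ≤ m) :
    stabTo h (fun i => FreeGroup.of i) = fun i => FreeGroup.of i := by
  funext j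
  by_cases hj : (j : ℕ) < k
  · simp [stabTo, hj]
  · simp [stabTo, hj]

theorem stabTo_trans {k m l : ℕ} (h : k ≤ m) (h' : m ≤ l) (r : Fin k → FreeGroup (Fin k)) :
    stabTo h' (stabTo h r) = stabTo (h.trans h') r := by
  funext j
  by_cases hj : (j : ℕ) < k
  · have hm : (j : ℕ) < m := lt_of_lt_of_le hj h
    simp [stabTo, hj, hm, FreeGroup.map.comp]
  · by_cases hm : (j : ℕ) < m
    · simp [stabTo, hj, hm]
    · simp [stabTo, hj, hm]

theorem stabTo_snoc {k m : ℕ} (h : k + 1 ≤ m) (r : Fin k → FreeGroup (Fin k)) :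
    stabTo (k := k + 1) h
      (Fin.snoc (fun i => FreeGroup.map Fin.castSucc (r i)) (FreeGroup.of (Fin.last k))) =
      stabTo (k.le_succ.trans h) r := by
  rw [← stabTo_trans k.le_succ h]
  congr 1
  funext j
  refine Fin.lastCases ?_ (fun i => ?_) j
  · simp [stabTo]
  · simp [stabTo]
    rfl

/-- Extension of an endomorphism by the identity on new generators. -/
def extHom {k m : ℕ} (h : k ≤ m) (ψ : FreeGroup (Fin k) →* FreeGroup (Fin k)) :
    FreeGroup (Fin m) →* FreeGroup (Fin m) :=
  FreeGroup.lift (stabTo h (fun i => ψ (FreeGroup.of i)))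

theorem extHom_map {k m : ℕ} (h : k ≤ m) (ψ : FreeGroup (Fin k) →* FreeGroup (Fin k))
    (w : FreeGroup (Fin k)) :
    extHom h ψ (FreeGroup.map (Fin.castLE h) w) = FreeGroup.map (Fin.castLE h) (ψ w) := by
  have : (extHom h ψ).comp (FreeGroup.map (Fin.castLE h)) =
      (FreeGroup.map (Fin.castLE h)).comp ψ := by
    ext i
    simp [extHom, stabTo_castLE]
  exact DFunLike.congr_fun this w

theorem extHom_stabTo {k m : ℕ} (h : k ≤ m) (ψ : FreeGroup (Fin k) →* FreeGroup (Fin k))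
    (r : Fin k → FreeGroup (Fin k)) (i : Fin m) :
    extHom h ψ (stabTo h r i) = stabTo h (fun i => ψ (r i)) i := by
  by_cases hi : (i : ℕ) < k
  · simp only [stabTo, hi, dif_pos, extHom_map]
  · simp [stabTo, hi, extHom]

theorem extHom_comp {k m : ℕ} (h : k ≤ m) (ψ φ : FreeGroup (Fin k) →* FreeGroup (Fin k))
    (e : ψ.comp φ = MonoidHom.id _) : (extHom h ψ).comp (extHom h φ) = MonoidHom.id _ := by
  ext i
  have : extHom h φ (FreeGroup.of i) = stabTo h (fun i => φ (FreeGroup.of i)) i := by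
    simp [extHom]
  rw [MonoidHom.comp_apply, this, extHom_stabTo]
  have e' : ∀ w, ψ (φ w) = w := fun w => DFunLike.congr_fun e w
  simp only [e', stabTo_of, MonoidHom.id_apply]

theorem move_stabTo {k m : ℕ} (h : k ≤ m) {r s : Fin k → FreeGroup (Fin k)}
    (hm : Move1235 k r s) : Move1235 m (stabTo h r) (stabTo h s) := by
  cases hm with
  | inv i =>
    rw [stabTo_update, map_inv, ← stabTo_castLE]
    exact .inv _ _
  | mul i j hij =>
    rw [stabTo_update, map_mul, ← stabTo_castLE, ← stabTo_castLE]
    exact .mul _ _ _ (fun e => hij (Fin.castLE_injective h e))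
  | conj i j =>
    rw [stabTo_update, map_mul, map_mul, map_inv, ← stabTo_castLE h r i, FreeGroup.map.of]
    exact .conj _ _ _
  | conjInv i j =>
    rw [stabTo_update, map_mul, map_mul, map_inv, ← stabTo_castLE h r i, FreeGroup.map.of]
    exact .conjInv _ _ _
  | auto ψ =>
    have := Move1235.auto (stabTo h r)
      (MonoidHom.toMulEquiv (extHom h ψ.toMonoidHom) (extHom h ψ.symm.toMonoidHom)
        (extHom_comp h _ _ (by ext; simp)) (extHom_comp h _ _ (by ext; simp)))
    convert this using 1
    funext i
    exact (extHom_stabTo h ψ.toMonoidHom r i).symm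

/-- Some stabilization is trivializable by moves (1), (2), (3), (5). -/
def StabTriv (p : Σ n : ℕ, Fin n → FreeGroup (Fin n)) : Prop :=
  ∃ (m : ℕ) (h : p.1 ≤ m),
    Relation.ReflTransGen (Move1235 m) (stabTo h p.2) (fun i => FreeGroup.of i)

theorem StabTriv.of_move {k : ℕ} {r s : Fin k → FreeGroup (Fin k)}
    (hm : Move1235 k r s) (hs : StabTriv ⟨k, s⟩) : StabTriv ⟨k, r⟩ := by
  obtain ⟨m, h, H⟩ := hs
  exact ⟨m, h, H.head (move_stabTo h hm)⟩

theorem StabTriv.of_qmove {p q : Σ n : ℕ, Fin n → FreeGroup (Fin n)}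
    (hm : QMove p q) (hs : StabTriv q) : StabTriv p := by
  cases hm with
  | inv n r i => exact hs.of_move (.inv _ _)
  | mul n r i j hij => exact hs.of_move (.mul _ _ _ hij)
  | conj n r i j => exact hs.of_move (.conj _ _ _)
  | conjInv n r i j => exact hs.of_move (.conjInv _ _ _)
  | auto n r ψ => exact hs.of_move (.auto _ _)
  | stab n r =>
    obtain ⟨m, h, H⟩ := hs
    refine ⟨m, n.le_succ.trans h, ?_⟩
    dsimp only at h H ⊢
    rwa [stabTo_snoc] at H
  | destab n r =>
    obtain ⟨m, h, H⟩ := hs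
    refine ⟨m + 1, Nat.succ_le_succ h, ?_⟩
    have := H.lift (stabTo m.le_succ) (fun _ _ => move_stabTo m.le_succ)
    rw [Function.onFun, stabTo_of, stabTo_trans] at this
    dsimp only at h this ⊢
    rwa [stabTo_snoc]

/-- If a balanced presentation `(r_1, …, r_n)` can be converted to the trivial
presentation by a finite sequence of moves (1)-(5), then there is an `m ≥ n` such that
the stabilized presentation `(r_1, …, r_n, x_{n+1}, …, x_m)` with `m` generators can be
converted to the trivial presentation `(x_1, …, x_m)` by moves (1), (2), (3) and (5)
only. -/
theorem stabilized_trivializable_of_moves12345 (n : ℕ) (r : Fin n → FreeGroup (Fin n))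
    (h : Relation.ReflTransGen QMove ⟨n, r⟩ ⟨n, fun i => FreeGroup.of i⟩) :
    ∃ (m : ℕ) (hnm : n ≤ m),
      Relation.ReflTransGen (Move1235 m)
        (fun i : Fin m =>
          if hi : (i : ℕ) < n then FreeGroup.map (Fin.castLE hnm) (r ⟨i, hi⟩)
          else FreeGroup.of i)
        (fun i => FreeGroup.of i) := by
  have key : ∀ p q, Relation.ReflTransGen QMove p q → StabTriv q → StabTriv p := by
    intro p q h hq
    induction h using Relation.ReflTransGen.head_induction_on with
    | refl => exact hq
    | head hm _ ih => exact ih.of_qmove hm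
  exact key _ _ h ⟨n, le_rfl, by rw [stabTo_of]⟩
end

section
/- For every natural number n, the balanced presentation ⟨x, y | x⁻¹(yx⁻¹)ⁿy⁻¹(y⁻¹x)ⁿy, x⁻¹(yx⁻¹)ⁿy⁻¹(xy⁻¹)ⁿ⟩ of the trivial group (the presentation P(3,2;4/(4n+1)) arising from the R-link L(3,2;4/(4n+1))) is AC-trivial. -/
/-- The first generator `x` of the free group `F_2` on two generators. -/
def x : FreeGroup (Fin 2) := FreeGroup.of 0

/-- The second generator `y` of the free group `F_2` on two generators. -/
def y : FreeGroup (Fin 2) := FreeGroup.of 1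

theorem T_of_move {a b a' b' : FreeGroup (Fin 2)} (h : ACMove ⟨2, ![a, b]⟩ ⟨2, ![a', b']⟩)
    (t : ACTrivial ![a', b']) : ACTrivial ![a, b] :=
  Relation.ReflTransGen.head h t

theorem up0 (a b c : FreeGroup (Fin 2)) : Function.update ![a, b] 0 c = ![c, b] := by
  ext i; fin_cases i <;> simp

theorem up1 (a b c : FreeGroup (Fin 2)) : Function.update ![a, b] 1 c = ![a, c] := by
  ext i; fin_cases i <;> simp

theorem T_inv0 {a b : FreeGroup (Fin 2)} (t : ACTrivial ![a⁻¹, b]) : ACTrivial ![a, b] := by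
  have h := ACMove.inv 2 ![a, b] 0
  rw [up0] at h
  exact T_of_move h t

theorem T_inv1 {a b : FreeGroup (Fin 2)} (t : ACTrivial ![a, b⁻¹]) : ACTrivial ![a, b] := by
  have h := ACMove.inv 2 ![a, b] 1
  rw [up1] at h
  exact T_of_move h t

theorem T_mul0 {a b : FreeGroup (Fin 2)} (t : ACTrivial ![a * b, b]) : ACTrivial ![a, b] := by
  have h := ACMove.mul 2 ![a, b] 0 1 (by decide)
  rw [up0] at h
  exact T_of_move h t

theorem T_mul1 {a b : FreeGroup (Fin 2)} (t : ACTrivial ![a, b * a]) : ACTrivial ![a, b] := by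
  have h := ACMove.mul 2 ![a, b] 1 0 (by decide)
  rw [up1] at h
  exact T_of_move h t

theorem T_conj0 (g : FreeGroup (Fin 2)) :
    ∀ {a b : FreeGroup (Fin 2)}, ACTrivial ![g * a * g⁻¹, b] → ACTrivial ![a, b] := by
  induction g using FreeGroup.induction_on with
  | C1 => intro a b t; simpa using t
  | of j =>
    intro a b t
    have h := ACMove.conj 2 ![a, b] 0 j
    rw [up0] at h
    exact T_of_move h t
  | inv_of j _ =>
    intro a b t
    have h := ACMove.conjInv 2 ![a, b] 0 j
    rw [up0] at h
    exact T_of_move h (by simpa using t)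
  | mul g k hg hk =>
    intro a b t
    exact hk (hg (by simpa [mul_assoc] using t))

theorem T_conj1 (g : FreeGroup (Fin 2)) :
    ∀ {a b : FreeGroup (Fin 2)}, ACTrivial ![a, g * b * g⁻¹] → ACTrivial ![a, b] := by
  induction g using FreeGroup.induction_on with
  | C1 => intro a b t; simpa using t
  | of j =>
    intro a b t
    have h := ACMove.conj 2 ![a, b] 1 j
    rw [up1] at h
    exact T_of_move h t
  | inv_of j _ =>
    intro a b t
    have h := ACMove.conjInv 2 ![a, b] 1 j
    rw [up1] at h
    exact T_of_move h (by simpa using t)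
  | mul g k hg hk =>
    intro a b t
    exact hk (hg (by simpa [mul_assoc] using t))

theorem closure_aux (P : FreeGroup (Fin 2) → Prop) (b : FreeGroup (Fin 2))
    (h1 : ∀ g a, P (a * (g * b * g⁻¹)) → P a) (h2 : ∀ g a, P (a * (g * b * g⁻¹)⁻¹) → P a)
    {k : FreeGroup (Fin 2)} (hk : k ∈ Subgroup.normalClosure {b}) :
    ∀ a, (P (a * k) → P a) ∧ (P (a * k⁻¹) → P a) := by
  unfold Subgroup.normalClosure at hk
  induction hk using Subgroup.closure_induction with
  | mem z hz =>
    intro a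
    rw [Group.mem_conjugatesOfSet_iff] at hz
    obtain ⟨c, hc, hz⟩ := hz
    obtain rfl : c = b := hc
    obtain ⟨g, rfl⟩ := isConj_iff.1 hz
    exact ⟨h1 g a, h2 g a⟩
  | one => intro a; simp
  | mul u v _ _ hu hv =>
    intro a
    refine ⟨fun t => (hu a).1 ((hv _).1 (by rwa [mul_assoc])), fun t => ?_⟩
    exact (hv a).2 ((hu _).2 (by simpa [mul_assoc] using t))
  | inv u _ hu =>
    intro a
    exact ⟨(hu a).2, fun t => (hu a).1 (by simpa using t)⟩

theorem T_mod0 {a b : FreeGroup (Fin 2)} (a' : FreeGroup (Fin 2))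
    (h : ∀ φ : FreeGroup (Fin 2) →* FreeGroup (Fin 2) ⧸ Subgroup.normalClosure {b},
      φ b = 1 → φ a = φ a')
    (t : ACTrivial ![a', b]) : ACTrivial ![a, b] := by
  have hm := h (QuotientGroup.mk' _)
    ((QuotientGroup.eq_one_iff b).2 (Subgroup.subset_normalClosure rfl))
  have hk := QuotientGroup.eq.1 hm
  have hA : ∀ (b g a : FreeGroup (Fin 2)),
      ACTrivial ![a * (g * b * g⁻¹), b] → ACTrivial ![a, b] := fun b g a t => by
    apply T_conj0 g⁻¹
    apply T_mul0
    apply T_conj0 g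
    simpa [mul_assoc] using t
  refine (closure_aux (fun a => ACTrivial ![a, b]) b (hA b) (fun g a t => ?_) hk a).1
    (by simpa using t)
  apply T_inv1
  apply hA b⁻¹ g
  apply T_inv1
  simpa [mul_assoc] using t

theorem T_swap {a b : FreeGroup (Fin 2)} (t : ACTrivial ![b, a]) : ACTrivial ![a, b] := by
  apply T_mul0
  apply T_inv0
  apply T_mul1
  apply T_mod0 b⁻¹
  · intro φ h
    simp at h
    simp [h]
  apply T_inv0
  apply T_inv1
  simpa using t

/-- The presentation `P(3,2;4/(4n+1)) = ⟨x, y | x⁻¹(yx⁻¹)ⁿy⁻¹(y⁻¹x)ⁿy,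
x⁻¹(yx⁻¹)ⁿy⁻¹(xy⁻¹)ⁿ⟩` is AC-trivial for every natural number `n`. -/
theorem acTrivial_P_4_4n1 (n : ℕ) :
    ACTrivial ![x⁻¹ * (y * x⁻¹) ^ n * y⁻¹ * (y⁻¹ * x) ^ n * y,
      x⁻¹ * (y * x⁻¹) ^ n * y⁻¹ * (x * y⁻¹) ^ n] := by
  apply T_mod0 ((x⁻¹ * (y * x⁻¹) ^ n) * (x ^ 2 * y)⁻¹ * (x⁻¹ * (y * x⁻¹) ^ n)⁻¹)
  · intro φ h
    simp only [map_mul, map_inv, map_pow] at h ⊢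
    generalize φ x = X at *
    generalize φ y = Y at *
    obtain ⟨W, rfl⟩ : ∃ W, Y = W * X := ⟨Y * X⁻¹, by group⟩
    have e1 : W * X * X⁻¹ = W := by group
    have e2 : X * (W * X)⁻¹ = W⁻¹ := by group
    have e3 : ((W * X)⁻¹ * X) ^ n = X⁻¹ * (W ^ n)⁻¹ * X := by
      have := conj_pow (i := n) (a := X⁻¹) (b := W⁻¹)
      simpa [mul_assoc] using this
    rw [e1, e2] at h
    rw [e1, e3]
    generalize hV : W ^ n = V at *
    rw [inv_pow, hV] at h
    have hc : W * V = V * W := by rw [← hV]; exact (Commute.self_pow W n)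
    have h' : X * W * V = V * X⁻¹ := by
      have h2 : X⁻¹ * V * (W * X)⁻¹ * V⁻¹ = (X⁻¹ * V * X⁻¹) * (V * W)⁻¹ := by
        group
      have h4 : X⁻¹ * V * X⁻¹ = V * W := mul_inv_eq_one.1 (h2.symm.trans h)
      rw [mul_assoc X W V, hc, ← h4]; group
    have h3 : X * W = V * X⁻¹ * V⁻¹ := by rw [← h']; group
    calc X⁻¹ * V * (W * X)⁻¹ * (X⁻¹ * V⁻¹ * X) * (W * X)
        = X⁻¹ * V * (W * X)⁻¹ * X⁻¹ * V⁻¹ * (X * W) * X := by group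
      _ = X⁻¹ * V * (X ^ 2 * (W * X))⁻¹ * (X⁻¹ * V)⁻¹ := by rw [h3]; group
  apply T_conj0 (x⁻¹ * (y * x⁻¹) ^ n)⁻¹
  apply T_inv0
  apply T_swap
  have e : ((x⁻¹ * (y * x⁻¹) ^ n)⁻¹ * (x⁻¹ * (y * x⁻¹) ^ n * (x ^ 2 * y)⁻¹ *
      (x⁻¹ * (y * x⁻¹) ^ n)⁻¹) * (x⁻¹ * (y * x⁻¹) ^ n)⁻¹⁻¹)⁻¹ = x ^ 2 * y := by group
  rw [e]
  apply T_mod0 x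
  · intro φ h
    simp only [map_mul, map_inv, map_pow] at h ⊢
    generalize φ x = X at *
    generalize φ y = Y at *
    obtain rfl : Y = (X ^ 2)⁻¹ := (inv_eq_of_mul_eq_one_right h).symm
    have e1 : (X ^ 2)⁻¹ * X⁻¹ = (X ^ 3)⁻¹ := by group
    have e2 : X * (X ^ 2)⁻¹⁻¹ = X ^ 3 := by group
    rw [e1, e2, inv_pow, ← pow_mul]
    group
  apply T_swap
  apply T_mod0 y
  · intro φ h
    simp [h]
  apply T_swap
  have e : ![x, y] = fun i => FreeGroup.of i := by
    ext i; fin_cases i <;> rfl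
  rw [e]
  exact Relation.ReflTransGen.refl
end

section
/- For every natural number n, the balanced presentation ⟨x, y | y⁻¹(x⁻¹y⁻¹x⁻¹)ⁿ(yx²)ⁿyx, x⁻¹(y⁻¹x⁻²)ⁿy⁻¹x⁻¹y⁻¹(xyx)ⁿxy⟩ of the trivial group (the presentation P(3,2;4/(4n+3)) arising from the R-link L(3,2;4/(4n+3))) is AC-trivial. -/
theorem ac_conj_gen {n : ℕ} (i : Fin n) (g : FreeGroup (Fin n)) :
    ∀ r : Fin n → FreeGroup (Fin n),
      ACEquiv ⟨n, r⟩ ⟨n, Function.update r i (g * r i * g⁻¹)⟩ := by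
  induction g using FreeGroup.induction_on with
  | C1 =>
    intro r
    simp only [one_mul, inv_one, mul_one, Function.update_eq_self]
    exact Relation.ReflTransGen.refl
  | of j => intro r; exact Relation.ReflTransGen.single (ACMove.conj n r i j)
  | inv_of j _ =>
    intro r
    have h := ACMove.conjInv n r i j
    rw [inv_inv]
    exact Relation.ReflTransGen.single h
  | mul a b ha hb =>
    intro r
    have h1 := hb r
    have h2 := ha (Function.update r i (b * r i * b⁻¹))
    rw [Function.update_idem, Function.update_self] at h2
    have e : a * b * r i * (a * b)⁻¹ = a * (b * r i * b⁻¹) * a⁻¹ := by group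
    rw [e]
    exact Relation.ReflTransGen.trans h1 h2

theorem ac_mul_conj {n : ℕ} (i j : Fin n) (hij : i ≠ j) (g : FreeGroup (Fin n))
    (r : Fin n → FreeGroup (Fin n)) :
    ACEquiv ⟨n, r⟩ ⟨n, Function.update r i (r i * (g * r j * g⁻¹))⟩ := by
  have h1 := ac_conj_gen i g⁻¹ r
  have h2 := ACMove.mul n (Function.update r i (g⁻¹ * r i * g⁻¹⁻¹)) i j hij
  have h3 := ac_conj_gen i g
    (Function.update r i (g⁻¹ * r i * g⁻¹⁻¹ * r j))
  simp only [Function.update_idem, Function.update_self,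
    Function.update_of_ne hij.symm] at h2 h3
  have e : g * (g⁻¹ * r i * g⁻¹⁻¹ * r j) * g⁻¹ = r i * (g * r j * g⁻¹) := by group
  rw [e] at h3
  exact (h1.trans (Relation.ReflTransGen.single h2)).trans h3

theorem ac_mul_conj_inv {n : ℕ} (i j : Fin n) (hij : i ≠ j) (g : FreeGroup (Fin n))
    (r : Fin n → FreeGroup (Fin n)) :
    ACEquiv ⟨n, r⟩ ⟨n, Function.update r i (r i * (g * r j * g⁻¹)⁻¹)⟩ := by
  have h1 := ACMove.inv n r j
  have h2 := ac_mul_conj i j hij g (Function.update r j (r j)⁻¹)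
  have h3 := ACMove.inv n (Function.update (Function.update r j (r j)⁻¹) i
    (r i * (g * (r j)⁻¹ * g⁻¹))) j
  simp only [Function.update_self, Function.update_of_ne hij,
    Function.update_of_ne hij.symm, inv_inv] at h2 h3
  have e3 : Function.update (Function.update (Function.update r j (r j)⁻¹) i
      (r i * (g * (r j)⁻¹ * g⁻¹))) j (r j) =
      Function.update r i (r i * (g * (r j)⁻¹ * g⁻¹)) := by
    rw [Function.update_comm hij, Function.update_idem, Function.update_eq_self]
  rw [e3] at h3
  have e : (g * r j * g⁻¹)⁻¹ = g * (r j)⁻¹ * g⁻¹ := by group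
  rw [e]
  exact ((Relation.ReflTransGen.single h1).trans h2).trans (Relation.ReflTransGen.single h3)

theorem ac_mul_closure {n : ℕ} (i j : Fin n) (hij : i ≠ j) (s k : FreeGroup (Fin n))
    (hk : k ∈ Subgroup.normalClosure {s}) :
    ∀ r : Fin n → FreeGroup (Fin n), r j = s →
      ACEquiv ⟨n, r⟩ ⟨n, Function.update r i (r i * k)⟩ := by
  have step : ∀ a b : FreeGroup (Fin n),
      (∀ r : Fin n → FreeGroup (Fin n), r j = s →
        ACEquiv ⟨n, r⟩ ⟨n, Function.update r i (r i * a)⟩) →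
      (∀ r : Fin n → FreeGroup (Fin n), r j = s →
        ACEquiv ⟨n, r⟩ ⟨n, Function.update r i (r i * b)⟩) →
      (∀ r : Fin n → FreeGroup (Fin n), r j = s →
        ACEquiv ⟨n, r⟩ ⟨n, Function.update r i (r i * (a * b))⟩) := by
    intro a b ha hb r hr
    have h1 := ha r hr
    have h2 := hb (Function.update r i (r i * a)) (by rw [Function.update_of_ne hij.symm, hr])
    rw [Function.update_idem, Function.update_self, mul_assoc] at h2
    exact Relation.ReflTransGen.trans h1 h2
  unfold Subgroup.normalClosure at hk
  induction hk using Subgroup.closure_induction'' with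
  | mem x hx =>
    intro r hr
    simp only [Group.mem_conjugatesOfSet_iff, Set.mem_singleton_iff, exists_eq_left,
      isConj_iff] at hx
    obtain ⟨c, rfl⟩ := hx
    rw [← hr]
    exact ac_mul_conj i j hij c r
  | inv_mem x hx =>
    intro r hr
    simp only [Group.mem_conjugatesOfSet_iff, Set.mem_singleton_iff, exists_eq_left,
      isConj_iff] at hx
    obtain ⟨c, rfl⟩ := hx
    rw [← hr]
    exact ac_mul_conj_inv i j hij c r
  | one =>
    intro r hr
    rw [mul_one, Function.update_eq_self]
    exact Relation.ReflTransGen.refl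
  | mul a b _ _ ha hb => exact step a b ha hb

/-- Replace a relator by one equal to it modulo the other relator. -/
theorem ac_replace {n : ℕ} (r : Fin n → FreeGroup (Fin n)) (i j : Fin n) (hij : i ≠ j)
    (t : FreeGroup (Fin n))
    (h : (QuotientGroup.mk (r i) : FreeGroup (Fin n) ⧸ Subgroup.normalClosure {r j}) =
      QuotientGroup.mk t) :
    ACEquiv ⟨n, r⟩ ⟨n, Function.update r i t⟩ := by
  have := ac_mul_closure i j hij (r j) ((r i)⁻¹ * t) (QuotientGroup.eq.1 h) r rfl
  rwa [mul_inv_cancel_left] at this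

theorem mk_self_eq_one {G : Type*} [Group G] (s : G) :
    (QuotientGroup.mk s : G ⧸ Subgroup.normalClosure {s}) = 1 :=
  (QuotientGroup.eq_one_iff s).2 (Subgroup.subset_normalClosure rfl)

theorem key1 {G : Type*} [Group G] (n : ℕ) (X Y : G)
    (h : Y⁻¹ * (X⁻¹ * Y⁻¹ * X⁻¹) ^ n * (Y * X ^ 2) ^ n * Y * X = 1) :
    X⁻¹ * (Y⁻¹ * (X ^ 2)⁻¹) ^ n * Y⁻¹ * X⁻¹ * Y⁻¹ * (X * Y * X) ^ n * X * Y
      = Y⁻¹ * Y⁻¹ * X * Y := by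
  obtain ⟨A, hA⟩ : ∃ A, A = X * Y * X := ⟨_, rfl⟩
  have hY : Y = X⁻¹ * A * X⁻¹ := by rw [hA]; group
  have e1 : X⁻¹ * Y⁻¹ * X⁻¹ = A⁻¹ := by rw [hA]; group
  have e2 : Y * X ^ 2 = X⁻¹ * A * X⁻¹⁻¹ := by rw [hA, pow_two]; group
  have e3 : Y⁻¹ * (X ^ 2)⁻¹ = X * A⁻¹ * X⁻¹ := by rw [hA, pow_two]; group
  rw [e1, e2, conj_pow, inv_pow] at h
  rw [e3, conj_pow, ← hA, inv_pow]
  have hc : A * A ^ n = A ^ n * A := (pow_succ' A n).symm.trans (pow_succ A n)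
  generalize A ^ n = B at *
  subst hY
  clear hA e1 e2 e3
  have k : X * B = B * A * X * A⁻¹ * X := by
    have h' : X * A⁻¹ * X * B⁻¹ * X⁻¹ * B * A = 1 := by
      rw [← h]; group
    calc X * B = (B * A) * (X * A⁻¹ * X * B⁻¹ * X⁻¹ * B * A) * (B * A)⁻¹ * (X * B) := by
          rw [h']; group
      _ = _ := by group
  have hB : A⁻¹ * B * A = B := by rw [mul_assoc, ← hc]; group
  calc _ = B⁻¹ * A⁻¹ * X * A⁻¹ * (X * B) * A * X⁻¹ := by group
    _ = B⁻¹ * A⁻¹ * X * (A⁻¹ * B * A) * X * A⁻¹ * X * A * X⁻¹ := by rw [k]; group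
    _ = B⁻¹ * A⁻¹ * (X * B) * X * A⁻¹ * X * A * X⁻¹ := by rw [hB]; group
    _ = (A * B)⁻¹ * (B * A) * X * A⁻¹ * X * X * A⁻¹ * X * A * X⁻¹ := by
        rw [k]; simp only [mul_inv_rev, mul_assoc]
    _ = _ := by rw [hc]; group

theorem key2 {G : Type*} [Group G] (n : ℕ) (X Y : G) (h : Y⁻¹ * Y⁻¹ * X * Y = 1) :
    Y⁻¹ * (X⁻¹ * Y⁻¹ * X⁻¹) ^ n * (Y * X ^ 2) ^ n * Y * X = X := by
  have : X = Y := by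
    have := congrArg (fun z => Y * Y * z * Y⁻¹) h
    simpa [mul_assoc] using this
  subst this
  have e : X⁻¹ * X⁻¹ * X⁻¹ = (X * X ^ 2)⁻¹ := by rw [pow_two]; group
  rw [e, inv_pow]
  group

theorem acTrivial_P_4_4n3 (n : ℕ) :
    ACTrivial ![y⁻¹ * (x⁻¹ * y⁻¹ * x⁻¹) ^ n * (y * x ^ 2) ^ n * y * x,
      x⁻¹ * (y⁻¹ * (x ^ 2)⁻¹) ^ n * y⁻¹ * x⁻¹ * y⁻¹ * (x * y * x) ^ n * x * y] := by
  unfold ACTrivial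
  have h1 := ac_replace ![y⁻¹ * (x⁻¹ * y⁻¹ * x⁻¹) ^ n * (y * x ^ 2) ^ n * y * x,
      x⁻¹ * (y⁻¹ * (x ^ 2)⁻¹) ^ n * y⁻¹ * x⁻¹ * y⁻¹ * (x * y * x) ^ n * x * y] 1 0
      (by decide) (y⁻¹ * y⁻¹ * x * y) (by
        have hm := mk_self_eq_one (y⁻¹ * (x⁻¹ * y⁻¹ * x⁻¹) ^ n * (y * x ^ 2) ^ n * y * x)
        simp only [QuotientGroup.mk_mul, QuotientGroup.mk_pow, QuotientGroup.mk_inv] at hm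
        have hk := key1 n _ _ hm
        simp only [← QuotientGroup.mk_mul, ← QuotientGroup.mk_pow, ← QuotientGroup.mk_inv] at hk
        exact hk)
  have h2 := ac_replace ![y⁻¹ * (x⁻¹ * y⁻¹ * x⁻¹) ^ n * (y * x ^ 2) ^ n * y * x,
      y⁻¹ * y⁻¹ * x * y] 0 1 (by decide) x (by
        have hm := mk_self_eq_one (y⁻¹ * y⁻¹ * x * y)
        simp only [QuotientGroup.mk_mul, QuotientGroup.mk_inv] at hm
        have hk := key2 n _ _ hm
        simp only [← QuotientGroup.mk_mul, ← QuotientGroup.mk_pow, ← QuotientGroup.mk_inv] at hk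
        exact hk)
  have h3 := ACMove.inv 2 ![x, y⁻¹ * y⁻¹ * x * y] 1
  have h4 := ac_replace ![x, (y⁻¹ * y⁻¹ * x * y)⁻¹] 1 0 (by decide) y (by
    have h : (QuotientGroup.mk x : FreeGroup (Fin 2) ⧸ Subgroup.normalClosure {x}) = 1 :=
      mk_self_eq_one x
    change ((QuotientGroup.mk y)⁻¹ * (QuotientGroup.mk y)⁻¹ * QuotientGroup.mk x *
      QuotientGroup.mk y)⁻¹ = (QuotientGroup.mk y :
        FreeGroup (Fin 2) ⧸ Subgroup.normalClosure {x})
    rw [h]; group)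
  have u1 : ∀ a b c : FreeGroup (Fin 2), Function.update ![a, b] 1 c = ![a, c] := by
    intro a b c; ext i; fin_cases i <;> rfl
  have u0 : ∀ a b c : FreeGroup (Fin 2), Function.update ![a, b] 0 c = ![c, b] := by
    intro a b c; ext i; fin_cases i <;> rfl
  rw [u1] at h1 h3 h4
  rw [u0] at h2
  have e : (fun i => FreeGroup.of i : Fin 2 → FreeGroup (Fin 2)) = ![x, y] := by
    ext i; fin_cases i <;> rfl
  rw [e]
  exact ((Relation.ReflTransGen.trans h1 h2).trans (Relation.ReflTransGen.single h3)).trans h4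
end

section
/- For every natural number n, the normal closure in the free group F_2 on generators x and y of the two elements r = x⁻¹(yx⁻¹)ⁿy⁻¹(y⁻¹x)ⁿy and s = x⁻¹(yx⁻¹)ⁿy⁻¹(xy⁻¹)ⁿ is all of F_2; equivalently, the group presented by ⟨x, y | x⁻¹(yx⁻¹)ⁿy⁻¹(y⁻¹x)ⁿy, x⁻¹(yx⁻¹)ⁿy⁻¹(xy⁻¹)ⁿ⟩ is trivial. -/
theorem aux_trivial {G : Type*} [Group G] (x y : G) (n : ℕ)
    (hr : x⁻¹ * (y * x⁻¹) ^ n * y⁻¹ * (y⁻¹ * x) ^ n * y = 1)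
    (hs : x⁻¹ * (y * x⁻¹) ^ n * y⁻¹ * (x * y⁻¹) ^ n = 1) : x = 1 ∧ y = 1 := by
  have h1 : (y⁻¹ * x) ^ n = y⁻¹ * (x * y⁻¹) ^ n * y := by
    have := conj_pow (a := y⁻¹) (b := x * y⁻¹) (i := n)
    rw [inv_inv] at this
    rw [← this]
    congr 1
    group
  have h2 : (x * y⁻¹) ^ n = ((y * x⁻¹) ^ n)⁻¹ := by
    rw [← inv_pow]; congr 1; group
  rw [h1, h2] at hr
  rw [h2] at hs
  have hc : y * x⁻¹ = y ^ 3 → (y * x⁻¹) ^ n * y⁻¹ * ((y * x⁻¹) ^ n)⁻¹ = y⁻¹ := by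
    intro h; rw [h]; group
  generalize (y * x⁻¹) ^ n = A at *
  have hs' : A * y⁻¹ * A⁻¹ = x := by
    have : x * (x⁻¹ * A * y⁻¹ * A⁻¹) = x := by rw [hs, mul_one]
    rw [← this]; group
  have hr' : x * y ^ 2 = 1 := by
    rw [← hr]
    have : x⁻¹ * A * y⁻¹ * (y⁻¹ * A⁻¹ * y) * y
        = x⁻¹ * (A * y⁻¹ * A⁻¹) * (A * y⁻¹ * A⁻¹) * y ^ 2 := by
      simp only [pow_two]; group
    rw [this, hs']; group
  have hx : x = (y ^ 2)⁻¹ := eq_inv_of_mul_eq_one_left hr'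
  have h3 := hc (by rw [hx]; group)
  rw [hs', hx] at h3
  have hy : y = 1 := by
    have h4 : y ^ 2 = y := inv_injective h3
    rw [pow_two] at h4
    exact mul_eq_left.mp h4
  exact ⟨by rw [hx, hy]; simp, hy⟩

/-- The normal closure in `F_2` of `r = x⁻¹(yx⁻¹)ⁿy⁻¹(y⁻¹x)ⁿy` and
`s = x⁻¹(yx⁻¹)ⁿy⁻¹(xy⁻¹)ⁿ` is all of `F_2`; i.e. the group `⟨x, y | r, s⟩` is trivial. -/
theorem normalClosure_P_4_4n1 (n : ℕ) :
    Subgroup.normalClosure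
      ({x⁻¹ * (y * x⁻¹) ^ n * y⁻¹ * (y⁻¹ * x) ^ n * y,
        x⁻¹ * (y * x⁻¹) ^ n * y⁻¹ * (x * y⁻¹) ^ n} : Set (FreeGroup (Fin 2))) = ⊤ := by
  set N := Subgroup.normalClosure
      ({x⁻¹ * (y * x⁻¹) ^ n * y⁻¹ * (y⁻¹ * x) ^ n * y,
        x⁻¹ * (y * x⁻¹) ^ n * y⁻¹ * (x * y⁻¹) ^ n} : Set (FreeGroup (Fin 2))) with hN
  have hr := (QuotientGroup.eq_one_iff (N := N) _).mpr
    (Subgroup.subset_normalClosure (Set.mem_insert _ _))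
  have hs := (QuotientGroup.eq_one_iff (N := N) _).mpr
    (Subgroup.subset_normalClosure (Set.mem_insert_of_mem _ (Set.mem_singleton _)))
  obtain ⟨hx, hy⟩ := aux_trivial (x : FreeGroup (Fin 2) ⧸ N) (y : FreeGroup (Fin 2) ⧸ N) n hr hs
  rw [QuotientGroup.eq_one_iff] at hx hy
  rw [eq_top_iff, ← FreeGroup.closure_range_of, Subgroup.closure_le]
  rintro _ ⟨i, rfl⟩
  fin_cases i
  · exact hx
  · exact hy
end

section
/- For every natural number n, the normal closure in the free group F_2 on generators x and y of the two elements r = y⁻¹(x⁻¹y⁻¹x⁻¹)ⁿ(yx²)ⁿyx and s = x⁻¹(y⁻¹x⁻²)ⁿy⁻¹x⁻¹y⁻¹(xyx)ⁿxy is all of F_2; equivalently, the group presented by ⟨x, y | y⁻¹(x⁻¹y⁻¹x⁻¹)ⁿ(yx²)ⁿyx, x⁻¹(y⁻¹x⁻²)ⁿy⁻¹x⁻¹y⁻¹(xyx)ⁿxy⟩ is trivial. -/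
theorem aux_core {G : Type*} [Group G] (x a A : G) (hc : a * A = A * a)
    (hxc : a = x * x * x → x * A = A * x)
    (hs : x * A * x⁻¹ = a * x⁻¹ * A) (hr : A * x = x * (A * a⁻¹) * x⁻¹ * a) :
    x = 1 ∧ a = 1 := by
  obtain ⟨u, hu⟩ : ∃ u, u = A⁻¹ * x * A := ⟨_, rfl⟩
  have hxA : x * A = A * u := by rw [hu]; group
  have h1 : a = x * A * x⁻¹ * A⁻¹ * x := by rw [hs]; group
  have h2 : a = u * x⁻¹ * u := by
    have e : a = A⁻¹ * a * A := by rw [mul_assoc, hc]; group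
    rw [e, h1, hu]; group
  have h3 : x * a = a * x⁻¹ * u := by
    have e : A * a⁻¹ = x⁻¹ * A * x * a⁻¹ * x := by
      have : A * x * a⁻¹ * x = x * (A * a⁻¹) := by rw [hr]; group
      calc A * a⁻¹ = x⁻¹ * (x * (A * a⁻¹)) := by group
        _ = _ := by rw [← this]; group
    have hc' : A * a⁻¹ = a⁻¹ * A := by
      calc A * a⁻¹ = a⁻¹ * (a * A) * a⁻¹ := by group
        _ = _ := by rw [hc]; group
    have hc2 : A⁻¹ * a = a * A⁻¹ := by
      calc A⁻¹ * a = A⁻¹ * (a * A) * A⁻¹ := by group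
        _ = _ := by rw [hc]; group
    have e2 : x⁻¹ * a = a * A⁻¹ * x⁻¹ * A * x := by
      calc x⁻¹ * a = (A * a⁻¹)⁻¹ * x⁻¹ * (x * (A * a⁻¹) * x⁻¹ * a) := by group
        _ = (A * a⁻¹)⁻¹ * x⁻¹ * (A * x) := by rw [hr]
        _ = _ := by group
    have e3 : a = x * a * (A⁻¹ * x⁻¹ * A * x) := by
      calc a = x * (x⁻¹ * a) := by group
        _ = _ := by rw [e2]; group
    calc x * a = x * a * (A⁻¹ * x⁻¹ * A * x) * (x⁻¹ * A⁻¹ * x * A) := by group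
      _ = a * (x⁻¹ * A⁻¹ * x * A) := by rw [← e3]
      _ = _ := by rw [hu]; group
  have h4 : u = x * x := by
    have e : x * (u * x⁻¹ * u) = (u * x⁻¹ * u) * x⁻¹ * u := by rw [← h2]; exact h3
    have e1 : x * u = u * x⁻¹ * u := by
      calc x * u = (x * (u * x⁻¹ * u)) * u⁻¹ * x := by group
        _ = _ := by rw [e]; group
    have e2 : x = u * x⁻¹ := by
      calc x = x * u * u⁻¹ := by group
        _ = _ := by rw [e1]; group
    calc u = u * x⁻¹ * x := by group
      _ = _ := by rw [← e2]
  have h5 : a = x * x * x := by rw [h2, h4]; group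
  have hx : x = 1 := by
    have e : u = x := by rw [hu, mul_assoc, hxc h5]; group
    rw [h4] at e
    simpa using e
  exact ⟨hx, by rw [h5, hx]; group⟩

theorem aux_group {G : Type*} [Group G] (x y : G) (n : ℕ)
    (hr : y⁻¹ * (x⁻¹ * y⁻¹ * x⁻¹) ^ n * (y * x ^ 2) ^ n * y * x = 1)
    (hs : x⁻¹ * (y⁻¹ * (x ^ 2)⁻¹) ^ n * y⁻¹ * x⁻¹ * y⁻¹ * (x * y * x) ^ n * x * y = 1) :
    x = 1 ∧ y = 1 := by
  obtain ⟨a, ha⟩ : ∃ a, a = y * x ^ 2 := ⟨_, rfl⟩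
  have hy : y = a * x⁻¹ * x⁻¹ := by rw [ha]; group
  have e1 : (x⁻¹ * y⁻¹ * x⁻¹) ^ n = x * (a ^ n)⁻¹ * x⁻¹ := by
    rw [← inv_pow, ← conj_pow]; congr 1; rw [ha]; group
  have e2 : (x * y * x) ^ n = x * a ^ n * x⁻¹ := by
    rw [← conj_pow]; congr 1; rw [ha]; group
  have e3 : (y⁻¹ * (x ^ 2)⁻¹) ^ n = (x * x) * (a ^ n)⁻¹ * (x * x)⁻¹ := by
    rw [← inv_pow a, ← conj_pow]; congr 1; rw [ha]; group
  rw [e1, ← ha] at hr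
  rw [e2, e3] at hs
  have hcn : a * a ^ n = a ^ n * a := (pow_mul_comm' a n).symm
  generalize hB : a ^ n = B at *
  have key := aux_core x a (B * a) (by rw [← mul_assoc, hcn]) (fun h => by
      have : Commute x a := by
        rw [h]; exact ((Commute.refl x).mul_right (Commute.refl x)).mul_right (Commute.refl x)
      rw [← hB]
      exact (this.pow_right n).mul_right this)
    (by
      subst hy
      have hs' : B * (a * x⁻¹ * x⁻¹) = x⁻¹ * (a * x⁻¹ * x⁻¹) * x * (a * B) * x⁻¹ := by
        rw [← mul_one (x⁻¹ * (a * x⁻¹ * x⁻¹) * x * (a * B) * x⁻¹), ← hs]; group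
      calc x * (B * a) * x⁻¹ = x * (B * (a * x⁻¹ * x⁻¹)) * x := by group
        _ = _ := by rw [hs', hcn]; group)
    (by
      subst hy
      have hr' : B * a * x⁻¹ = x * B * x⁻¹ * (a * x⁻¹ * x⁻¹) := by
        rw [← mul_one (x * B * x⁻¹ * (a * x⁻¹ * x⁻¹)), ← hr]; group
      calc B * a * x = B * a * x⁻¹ * x * x := by group
        _ = _ := by rw [hr']; group)
  refine ⟨key.1, ?_⟩
  rw [hy, key.1, key.2]; group

/-- The normal closure in `F_2` of `r = y⁻¹(x⁻¹y⁻¹x⁻¹)ⁿ(yx²)ⁿyx` and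
`s = x⁻¹(y⁻¹x⁻²)ⁿy⁻¹x⁻¹y⁻¹(xyx)ⁿxy` is all of `F_2`; i.e. the group `⟨x, y | r, s⟩` is
trivial. -/
theorem normalClosure_P_4_4n3 (n : ℕ) :
    Subgroup.normalClosure
      ({y⁻¹ * (x⁻¹ * y⁻¹ * x⁻¹) ^ n * (y * x ^ 2) ^ n * y * x,
        x⁻¹ * (y⁻¹ * (x ^ 2)⁻¹) ^ n * y⁻¹ * x⁻¹ * y⁻¹ * (x * y * x) ^ n * x * y} : Set (FreeGroup (Fin 2))) = ⊤ := by
  set S : Set (FreeGroup (Fin 2)) := {y⁻¹ * (x⁻¹ * y⁻¹ * x⁻¹) ^ n * (y * x ^ 2) ^ n * y * x,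
        x⁻¹ * (y⁻¹ * (x ^ 2)⁻¹) ^ n * y⁻¹ * x⁻¹ * y⁻¹ * (x * y * x) ^ n * x * y} with hS
  have h1 := (QuotientGroup.eq_one_iff (N := Subgroup.normalClosure S) _).2
    (Subgroup.subset_normalClosure (Set.mem_insert _ _))
  have h2 := (QuotientGroup.eq_one_iff (N := Subgroup.normalClosure S) _).2
    (Subgroup.subset_normalClosure (Set.mem_insert_of_mem _ (Set.mem_singleton _)))
  have h := aux_group (G := FreeGroup (Fin 2) ⧸ Subgroup.normalClosure S)
    (QuotientGroup.mk x) (QuotientGroup.mk y) n h1 h2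
  have hx := (QuotientGroup.eq_one_iff _).1 h.1
  have hy := (QuotientGroup.eq_one_iff _).1 h.2
  rw [eq_top_iff, ← FreeGroup.closure_range_of, Subgroup.closure_le]
  rintro _ ⟨i, rfl⟩
  have ex : FreeGroup.of (0 : Fin 2) = x := by unfold x; rfl
  have ey : FreeGroup.of (1 : Fin 2) = y := by unfold y; rfl
  rcases (by omega : i = 0 ∨ i = 1) with hi | hi
  · rw [hi, ex]; exact hx
  · rw [hi, ey]; exact hy
end

section
/- For every natural number n, the balanced presentation with two generators x, y and the two relators (x⁻¹y⁻¹x⁻¹)ⁿyx(xyx)ⁿy⁻¹ and y⁻¹x is AC-trivial. -/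
theorem ac_inv1 (a b : FreeGroup (Fin 2)) : ACEquiv ⟨2, ![a, b]⟩ ⟨2, ![a, b⁻¹]⟩ := by
  have h := ACMove.inv 2 ![a, b] 1
  have e : Function.update ![a, b] 1 (![a, b] 1)⁻¹ = ![a, b⁻¹] := by
    ext i; fin_cases i <;> simp
  rw [e] at h
  exact Relation.ReflTransGen.single h

theorem ac_mul0 (a b : FreeGroup (Fin 2)) : ACEquiv ⟨2, ![a, b]⟩ ⟨2, ![a * b, b]⟩ := by
  have h := ACMove.mul 2 ![a, b] 0 1 (by decide)
  have e : Function.update ![a, b] 0 (![a, b] 0 * ![a, b] 1) = ![a * b, b] := by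
    ext i; fin_cases i <;> simp
  rw [e] at h
  exact Relation.ReflTransGen.single h

theorem ac_mul1 (a b : FreeGroup (Fin 2)) : ACEquiv ⟨2, ![a, b]⟩ ⟨2, ![a, b * a]⟩ := by
  have h := ACMove.mul 2 ![a, b] 1 0 (by decide)
  have e : Function.update ![a, b] 1 (![a, b] 1 * ![a, b] 0) = ![a, b * a] := by
    ext i; fin_cases i <;> simp
  rw [e] at h
  exact Relation.ReflTransGen.single h

theorem ac_conj (w : FreeGroup (Fin 2)) : ∀ a b : FreeGroup (Fin 2),
    ACEquiv ⟨2, ![a, b]⟩ ⟨2, ![a, w * b * w⁻¹]⟩ := by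
  induction w using FreeGroup.induction_on with
  | C1 =>
    intro a b
    have : ACEquiv ⟨2, ![a, b]⟩ ⟨2, ![a, b]⟩ := Relation.ReflTransGen.refl
    simpa using this
  | of j =>
    intro a b
    have h := ACMove.conj 2 ![a, b] 1 j
    have e : Function.update ![a, b] 1 (FreeGroup.of j * ![a, b] 1 * (FreeGroup.of j)⁻¹)
        = ![a, FreeGroup.of j * b * (FreeGroup.of j)⁻¹] := by
      ext i; fin_cases i <;> simp
    rw [e] at h
    exact Relation.ReflTransGen.single h
  | inv_of j _ =>
    intro a b
    have h := ACMove.conjInv 2 ![a, b] 1 j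
    have e : Function.update ![a, b] 1 ((FreeGroup.of j)⁻¹ * ![a, b] 1 * FreeGroup.of j)
        = ![a, (FreeGroup.of j)⁻¹ * b * ((FreeGroup.of j)⁻¹)⁻¹] := by
      ext i; fin_cases i <;> simp
    rw [e] at h
    exact Relation.ReflTransGen.single h
  | mul u v hu hv =>
    intro a b
    have h := Relation.ReflTransGen.trans (hv a b) (hu a (v * b * v⁻¹))
    have e : u * v * b * (u * v)⁻¹ = u * (v * b * v⁻¹) * u⁻¹ := by group
    rw [e]; exact h

theorem ac_mulconj (w a b : FreeGroup (Fin 2)) :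
    ACEquiv ⟨2, ![a, b]⟩ ⟨2, ![a * (w * b * w⁻¹), b]⟩ := by
  have h := ((ac_conj w a b).trans (ac_mul0 _ _)).trans (ac_conj w⁻¹ _ _)
  have e : w⁻¹ * (w * b * w⁻¹) * w⁻¹⁻¹ = b := by group
  rw [e] at h; exact h

theorem ac_mulconj_inv (w a b : FreeGroup (Fin 2)) :
    ACEquiv ⟨2, ![a, b]⟩ ⟨2, ![a * (w * b * w⁻¹)⁻¹, b]⟩ := by
  have h := ((ac_inv1 a b).trans (ac_mulconj w _ _)).trans (ac_inv1 _ _)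
  have e : (w * b * w⁻¹)⁻¹ = w * b⁻¹ * w⁻¹ := by group
  rw [inv_inv] at h
  rw [e]; exact h

theorem ac_normal (b g : FreeGroup (Fin 2)) (hg : g ∈ Subgroup.normalClosure {b}) :
    ∀ a, ACEquiv ⟨2, ![a, b]⟩ ⟨2, ![a * g, b]⟩ ∧ ACEquiv ⟨2, ![a, b]⟩ ⟨2, ![a * g⁻¹, b]⟩ := by
  unfold Subgroup.normalClosure at hg
  induction hg using Subgroup.closure_induction with
  | mem g hg =>
    intro a
    obtain ⟨c, hc, hcg⟩ := Group.mem_conjugatesOfSet_iff.1 hg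
    rw [Set.mem_singleton_iff] at hc
    subst hc
    obtain ⟨w, rfl⟩ := isConj_iff.1 hcg
    exact ⟨ac_mulconj w a _, ac_mulconj_inv w a _⟩
  | one =>
    intro a
    have : ACEquiv ⟨2, ![a, b]⟩ ⟨2, ![a, b]⟩ := Relation.ReflTransGen.refl
    simpa using this
  | mul u v _ _ hu hv =>
    intro a
    have h1 := (hu a).1.trans (hv (a * u)).1
    have h2 := (hv a).2.trans (hu (a * v⁻¹)).2
    rw [mul_inv_rev, ← mul_assoc, ← mul_assoc]
    exact ⟨h1, h2⟩
  | inv u _ hu =>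
    intro a
    rw [inv_inv]
    exact ⟨(hu a).2, (hu a).1⟩

theorem aux_group_s15 {G : Type*} [Group G] (X : G) (n : ℕ) :
    (X⁻¹ * X⁻¹ * X⁻¹) ^ n * X * X * (X * X * X) ^ n * X⁻¹ = X := by
  have h : X * X * X = X ^ 3 := by simp [pow_succ]
  have h' : X⁻¹ * X⁻¹ * X⁻¹ = (X ^ 3)⁻¹ := by simp [pow_succ, mul_assoc]
  rw [h, h', inv_pow, ← pow_mul]
  group

/-- The presentation with relators `(x⁻¹y⁻¹x⁻¹)ⁿyx(xyx)ⁿy⁻¹` and `y⁻¹x` is AC-trivial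
for every natural number `n`. -/
theorem acTrivial_intermediate_4n3 (n : ℕ) :
    ACTrivial ![(x⁻¹ * y⁻¹ * x⁻¹) ^ n * y * x * (x * y * x) ^ n * y⁻¹, y⁻¹ * x] := by
  set r := (x⁻¹ * y⁻¹ * x⁻¹) ^ n * y * x * (x * y * x) ^ n * y⁻¹ with hr
  have hmem : r⁻¹ * x ∈ Subgroup.normalClosure {y⁻¹ * x} := by
    rw [← QuotientGroup.eq]
    have hxy : ((y : FreeGroup (Fin 2)) : FreeGroup (Fin 2) ⧸ Subgroup.normalClosure {y⁻¹ * x})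
        = (x : FreeGroup (Fin 2)) := by
      rw [QuotientGroup.eq]
      exact Subgroup.subset_normalClosure rfl
    rw [hr]
    simp only [QuotientGroup.mk_mul, QuotientGroup.mk_pow, QuotientGroup.mk_inv, hxy]
    exact aux_group_s15 _ n
  have h1 := (ac_normal _ _ hmem r).1
  rw [mul_inv_cancel_left] at h1
  have h2 := ((h1.trans (ac_inv1 _ _)).trans (ac_conj x _ _)).trans (ac_mul1 _ _)
  have e : x * (y⁻¹ * x)⁻¹ * x⁻¹ * x = x * (x⁻¹ * y) := by group
  rw [e, mul_inv_cancel_left] at h2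
  have e2 : (![x, y] : Fin 2 → FreeGroup (Fin 2)) = fun i => FreeGroup.of i := by
    ext i; fin_cases i <;> rfl
  rw [e2] at h2
  exact h2
end
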